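/- arXiv:2108.13566 — 2 statements merged into one kernel-verified Lean document; each statement's English description precedes it below -/
import Mathlib

section
/- Fix an integer n ≥ 1, a sign assignment s, and a Maslov grading gr, and let (CD, δ) be the complex of positive domains defined from them. Then there exists a grid state x₀ such that, writing c for the basis element (x₀, x₀, 0) (the trivial domain at x₀): (1) δ c = 0; (2) for every v ∈ CD with δ v = 0 there exist m ∈ ℤ and w ∈ CD with v = m • c + δ w; and (3) for all m ∈ ℤ and w ∈ CD, if m • c = δ w then m = 0. In other words, the complex of positive domains has homology ℤ, supported in grading 0 and generated by a trivial domain. -/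
/-! Grid diagram combinatorics: the complex of positive domains `CD₊`. -/

/-- A domain on the `n × n` toroidal grid from grid state `x` to grid state `y`,
avoiding the distinguished top-right square. -/
def IsGridDomain (n : ℕ) (x y : Equiv.Perm (ZMod n)) (D : ZMod n → ZMod n → ℤ) : Prop :=
  D ((n : ZMod n) - 1) ((n : ZMod n) - 1) = 0 ∧
    ∀ i j : ZMod n,
      D i j - D (i - 1) j - D i (j - 1) + D (i - 1) (j - 1) =
        (if x i = j then 1 else 0) - (if y i = j then 1 else 0)

/-- A positive domain from `x` to `y`. -/
def IsGridPosDomain (n : ℕ) (x y : Equiv.Perm (ZMod n)) (D : ZMod n → ZMod n → ℤ) : Prop :=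
  IsGridDomain n x y D ∧ ∀ i j : ZMod n, 0 ≤ D i j

/-- Membership in the cyclic interval `[a, b)` of `ZMod n`. -/
def cycInt (n : ℕ) (a b i : ZMod n) : Prop :=
  ∃ k : ℕ, k < (b - a).val ∧ i = a + (k : ZMod n)

/-- A rectangle from `x` to `y`. -/
def IsGridRect (n : ℕ) (x y : Equiv.Perm (ZMod n)) (R : ZMod n → ZMod n → ℤ) : Prop :=
  IsGridPosDomain n x y R ∧
    ∃ i₁ i₂ : ZMod n, i₁ ≠ i₂ ∧
      y = x * Equiv.swap i₁ i₂ ∧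
      (∀ i j : ZMod n,
        (cycInt n i₁ i₂ i ∧ cycInt n (x i₁) (x i₂) j → R i j = 1) ∧
        (¬(cycInt n i₁ i₂ i ∧ cycInt n (x i₁) (x i₂) j) → R i j = 0)) ∧
      ∀ i : ZMod n, i ≠ i₁ → i ≠ i₂ → cycInt n i₁ i₂ i → ¬ cycInt n (x i₁) (x i₂) (x i)

/-- The horizontal annulus through row `j`. -/
def annH (n : ℕ) (j : ZMod n) : ZMod n → ZMod n → ℤ := fun _ j' => if j' = j then 1 else 0

/-- The vertical annulus through column `i`. -/
def annV (n : ℕ) (i : ZMod n) : ZMod n → ZMod n → ℤ := fun i' _ => if i' = i then 1 else 0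

/-- `A(D)`: multiplicities of `D` in the rightmost column. -/
def colA (n : ℕ) (D : ZMod n → ZMod n → ℤ) : {j : ZMod n // j ≠ (n : ZMod n) - 1} → ℤ :=
  fun j => D ((n : ZMod n) - 1) j.1

/-- `B(D)`: multiplicities of `D` in the topmost row. -/
def rowB (n : ℕ) (D : ZMod n → ZMod n → ℤ) : {i : ZMod n // i ≠ (n : ZMod n) - 1} → ℤ :=
  fun i => D i.1 ((n : ZMod n) - 1)

/-- A sign assignment on rectangles. -/
structure SignAssignment (n : ℕ) where
  s : Equiv.Perm (ZMod n) → Equiv.Perm (ZMod n) → (ZMod n → ZMod n → ℤ) → ℤ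
  s_unit : ∀ x w R, IsGridRect n x w R → s x w R = 1 ∨ s x w R = -1
  s_square : ∀ x y w₁ w₂ R₁ S₁ R₂ S₂,
    IsGridRect n x w₁ R₁ → IsGridRect n w₁ y S₁ →
    IsGridRect n x w₂ R₂ → IsGridRect n w₂ y S₂ →
    R₁ + S₁ = R₂ + S₂ →
    (w₁, R₁, S₁) ≠ (w₂, R₂, S₂) →
    (∀ j : ZMod n, j ≠ (n : ZMod n) - 1 → R₁ + S₁ ≠ annH n j) →
    (∀ i : ZMod n, i ≠ (n : ZMod n) - 1 → R₁ + S₁ ≠ annV n i) →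
    s x w₁ R₁ * s w₁ y S₁ = -(s x w₂ R₂ * s w₂ y S₂)
  s_horiz : ∀ x w R S, ∀ j : ZMod n, j ≠ (n : ZMod n) - 1 →
    IsGridRect n x w R → IsGridRect n w x S → R + S = annH n j →
    s x w R * s w x S = 1
  s_vert : ∀ x w R S, ∀ i : ZMod n, i ≠ (n : ZMod n) - 1 →
    IsGridRect n x w R → IsGridRect n w x S → R + S = annV n i →
    s x w R * s w x S = -1

/-- A Maslov grading on positive domains. -/
structure MaslovGrading (n : ℕ) where
  gr : Equiv.Perm (ZMod n) → Equiv.Perm (ZMod n) → (ZMod n → ZMod n → ℤ) → ℤ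
  gr_zero : ∀ x, gr x x 0 = 0
  gr_left : ∀ x w y R E, IsGridRect n x w R → IsGridPosDomain n w y E →
    gr x y (R + E) = 1 + gr w y E
  gr_right : ∀ x w y E R, IsGridPosDomain n x w E → IsGridRect n w y R →
    gr x y (E + R) = 1 + gr x w E

/-- Generators of the complex of positive domains: triples `(x, y, D)` with
`D` a positive domain from `x` to `y`. -/
abbrev GenCD (n : ℕ) :=
  {p : Equiv.Perm (ZMod n) × Equiv.Perm (ZMod n) × (ZMod n → ZMod n → ℤ) //
    IsGridPosDomain n p.1 p.2.1 p.2.2}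

/-- The complex of positive domains, as a free `ℤ`-module. -/
abbrev CDModule (n : ℕ) := GenCD n →₀ ℤ

/-- The differential of the complex of positive domains. -/
noncomputable def deltaCD (n : ℕ) (sgn : SignAssignment n) (grd : MaslovGrading n) :
    CDModule n →ₗ[ℤ] CDModule n :=
  Finsupp.lift (CDModule n) ℤ (GenCD n) fun g =>
    (∑ᶠ (w : Equiv.Perm (ZMod n)) (R : ZMod n → ZMod n → ℤ) (E : ZMod n → ZMod n → ℤ)
        (_ : IsGridRect n g.1.1 w R) (hE : IsGridPosDomain n w g.1.2.1 E)
        (_ : R + E = g.1.2.2),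
        sgn.s g.1.1 w R • Finsupp.single (⟨(w, g.1.2.1, E), hE⟩ : GenCD n) (1 : ℤ)) +
    (((-1 : ℤˣ) ^ grd.gr g.1.1 g.1.2.1 g.1.2.2 : ℤˣ) : ℤ) •
      (∑ᶠ (w : Equiv.Perm (ZMod n)) (E : ZMod n → ZMod n → ℤ) (R : ZMod n → ZMod n → ℤ)
        (hE : IsGridPosDomain n g.1.1 w E) (_ : IsGridRect n w g.1.2.1 R)
        (_ : E + R = g.1.2.2),
        sgn.s w g.1.2.1 R • Finsupp.single (⟨(g.1.1, w, E), hE⟩ : GenCD n) (1 : ℤ))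

/-- The trivial (zero) domain is a positive domain from any state to itself. -/
theorem isGridPosDomain_zero (n : ℕ) (x : Equiv.Perm (ZMod n)) :
    IsGridPosDomain n x x 0 := by
  refine ⟨⟨rfl, fun i j => ?_⟩, fun i j => le_refl _⟩
  simp

section
namespace GridCD

/-- Cyclic interval membership in terms of representatives. -/
def cN (a b i : ℕ) : Bool :=
  cond (Nat.blt a b) (and (Nat.ble a i) (Nat.blt i b)) (or (Nat.ble a i) (Nat.blt i b))

theorem cN_def (a b i : ℕ) : cN a b i = if a < b then (decide (a ≤ i) && decide (i < b)) else (decide (a ≤ i) || decide (i < b)) := by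
  unfold cN
  have h1 : ∀ p q : ℕ, Nat.ble p q = decide (p ≤ q) := fun p q => by
    rw [Bool.eq_iff_iff]; simp
  have h2 : ∀ p q : ℕ, Nat.blt p q = decide (p < q) := fun p q => by
    rw [Bool.eq_iff_iff]; simp [Nat.blt]
  simp only [h1, h2, cond_eq_ite, decide_eq_true_eq]

set_option linter.unusedSectionVars false

variable {n : ℕ} [NeZero n]

theorem val_sub_eq (a i : ZMod n) :
    (i - a).val = if a.val ≤ i.val then i.val - a.val else i.val + n - a.val := by
  have ha := ZMod.val_lt a
  have hi := ZMod.val_lt i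
  split_ifs with h
  · exact ZMod.val_sub h
  · have : i - a = ((i.val + n - a.val : ℕ) : ZMod n) := by
      rw [Nat.cast_sub (by omega)]; simp
    rw [this, ZMod.val_natCast, Nat.mod_eq_of_lt (by omega)]

theorem cycInt_iff' (a b i : ZMod n) : cycInt n a b i ↔ (i - a).val < (b - a).val := by
  constructor
  · rintro ⟨k, hk, rfl⟩
    have := ZMod.val_lt (b - a)
    simpa [ZMod.val_natCast, Nat.mod_eq_of_lt (hk.trans this)] using hk
  · intro h
    exact ⟨_, h, by simp⟩

theorem cycInt_iff (a b i : ZMod n) (hab : a ≠ b) :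
    cycInt n a b i ↔ cN a.val b.val i.val = true := by
  rw [cycInt_iff', val_sub_eq, val_sub_eq]
  have ha := ZMod.val_lt a
  have hi := ZMod.val_lt i
  have hb := ZMod.val_lt b
  have hab' : a.val ≠ b.val := fun h => hab (ZMod.val_injective n h)
  rw [cN_def]
  split_ifs <;> simp <;> omega

theorem val_neg_one' : ((-1 : ZMod n)).val = n - 1 := by
  have : n ≠ 0 := NeZero.ne n
  obtain ⟨m, rfl⟩ := Nat.exists_eq_succ_of_ne_zero this
  simp

theorem val_sub_one (i : ZMod n) : (i - 1).val = if i.val = 0 then n - 1 else i.val - 1 := by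
  have hi := ZMod.val_lt i
  by_cases h : i.val = 0
  · have : i = 0 := by simpa [ZMod.val_eq_zero] using h
    subst this
    simp [val_neg_one']
  · have hn : 1 < n := by omega
    have h1 : (1 : ZMod n).val = 1 := by
      rw [ZMod.val_one_eq_one_mod, Nat.mod_eq_of_lt hn]
    rw [val_sub_eq, h1]
    simp [h]

theorem val_add_one (i : ZMod n) : (i + 1).val = if i.val = n - 1 then 0 else i.val + 1 := by
  have := val_sub_one (i + 1)
  have hi := ZMod.val_lt i
  have hi' := ZMod.val_lt (i+1)
  simp only [add_sub_cancel_right] at this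
  split_ifs at * <;> omega

/-- indicator of a cyclic interval -/
def ind (a b i : ZMod n) : ℤ := if cN a.val b.val i.val then 1 else 0

theorem ind_sub (a b i : ZMod n) (hab : a ≠ b) :
    ind a b i - ind a b (i - 1) = (if i = a then 1 else 0) - (if i = b then 1 else 0) := by
  have ha := ZMod.val_lt a
  have hi := ZMod.val_lt i
  have hb := ZMod.val_lt b
  have hab' : a.val ≠ b.val := fun h => hab (ZMod.val_injective n h)
  have e1 : i = a ↔ i.val = a.val := ⟨fun h => h ▸ rfl, fun h => ZMod.val_injective n h⟩
  have e2 : i = b ↔ i.val = b.val := ⟨fun h => h ▸ rfl, fun h => ZMod.val_injective n h⟩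
  unfold ind
  simp only [cN_def]
  rw [val_sub_one]
  simp only [e1, e2]
  grind

/-- rectangle function -/
def rectFn (i₁ i₂ j₁ j₂ : ZMod n) : ZMod n → ZMod n → ℤ :=
  fun i j => ind i₁ i₂ i * ind j₁ j₂ j

theorem ind_nonneg (a b i : ZMod n) : 0 ≤ ind a b i := by
  unfold ind; split_ifs <;> simp

theorem ind_cases (a b i : ZMod n) : ind a b i = 0 ∨ ind a b i = 1 := by
  unfold ind; split_ifs <;> simp

theorem ind_eq_one (a b i : ZMod n) : ind a b i = 1 ↔ cN a.val b.val i.val = true := by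
  unfold ind; split_ifs with h <;> simp [h]

theorem rectFn_nonneg (i₁ i₂ j₁ j₂ i j : ZMod n) : 0 ≤ rectFn i₁ i₂ j₁ j₂ i j :=
  mul_nonneg (ind_nonneg _ _ _) (ind_nonneg _ _ _)

theorem rectFn_rel (x : Equiv.Perm (ZMod n)) (i₁ i₂ : ZMod n) (h : i₁ ≠ i₂) (i j : ZMod n) :
    rectFn i₁ i₂ (x i₁) (x i₂) i j - rectFn i₁ i₂ (x i₁) (x i₂) (i - 1) j
      - rectFn i₁ i₂ (x i₁) (x i₂) i (j - 1) + rectFn i₁ i₂ (x i₁) (x i₂) (i - 1) (j - 1) =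
        (if x i = j then 1 else 0) - (if (x * Equiv.swap i₁ i₂) i = j then 1 else 0) := by
  have h1 := ind_sub i₁ i₂ i h
  have h2 := ind_sub (x i₁) (x i₂) j (fun e => h (x.injective e))
  unfold rectFn
  have : ind i₁ i₂ i * ind (x i₁) (x i₂) j - ind i₁ i₂ (i-1) * ind (x i₁) (x i₂) j
     - ind i₁ i₂ i * ind (x i₁) (x i₂) (j-1) + ind i₁ i₂ (i-1) * ind (x i₁) (x i₂) (j-1) =
     (ind i₁ i₂ i - ind i₁ i₂ (i - 1)) * (ind (x i₁) (x i₂) j - ind (x i₁) (x i₂) (j - 1)) := by ring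
  rw [this, h1, h2]
  simp only [Equiv.Perm.mul_apply]
  by_cases e1 : i = i₁
  · subst e1
    simp [h, eq_comm (a := j)]
  · by_cases e2 : i = i₂
    · subst e2
      simp [e1, eq_comm (a := j)]
    · simp [e1, e2, Equiv.swap_apply_of_ne_of_ne e1 e2]

theorem rect_iff (x y : Equiv.Perm (ZMod n)) (R : ZMod n → ZMod n → ℤ) :
    IsGridRect n x y R ↔ ∃ i₁ i₂ : ZMod n, i₁ ≠ i₂ ∧ y = x * Equiv.swap i₁ i₂ ∧
      R = rectFn i₁ i₂ (x i₁) (x i₂) ∧ R (-1) (-1) = 0 ∧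
      ∀ i, i ≠ i₁ → i ≠ i₂ → R i (x i) = 0 := by
  have key : ∀ i₁ i₂ : ZMod n, i₁ ≠ i₂ → ∀ i j, (cycInt n i₁ i₂ i ∧ cycInt n (x i₁) (x i₂) j) ↔
      rectFn i₁ i₂ (x i₁) (x i₂) i j = 1 := by
    intro i₁ i₂ h i j
    rw [cycInt_iff _ _ _ h, cycInt_iff _ _ _ (fun e => h (x.injective e)), ← ind_eq_one,
      ← ind_eq_one]
    unfold rectFn
    rcases ind_cases i₁ i₂ i with h | h <;> rcases ind_cases (x i₁) (x i₂) j with h' | h' <;>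
      simp [h, h']
  have key0 : ∀ i₁ i₂ j₁ j₂ i j : ZMod n, rectFn i₁ i₂ j₁ j₂ i j ≠ 1 → 
      rectFn i₁ i₂ j₁ j₂ i j = 0 := by
    intro i₁ i₂ j₁ j₂ i j
    unfold rectFn
    rcases ind_cases i₁ i₂ i with h | h <;> rcases ind_cases j₁ j₂ j with h' | h' <;>
      simp [h, h']
  constructor
  · rintro ⟨⟨⟨h1, h2⟩, h3⟩, i₁, i₂, h, hy, hR, hE⟩
    refine ⟨i₁, i₂, h, hy, ?_, by simpa using h1, ?_⟩
    · funext i j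
      by_cases hc : rectFn i₁ i₂ (x i₁) (x i₂) i j = 1
      · rw [hc]; exact (hR i j).1 ((key _ _ h i j).2 hc)
      · rw [key0 _ _ _ _ _ _ hc]; exact (hR i j).2 (fun h' => hc ((key _ _ h i j).1 h'))
    · intro i hi1 hi2
      exact (hR i (x i)).2 (fun h' => hE i hi1 hi2 h'.1 h'.2)
  · rintro ⟨i₁, i₂, h, hy, rfl, h1, hE⟩
    refine ⟨⟨⟨by simpa using h1, fun i j => ?_⟩, fun i j => rectFn_nonneg _ _ _ _ _ _⟩,
      i₁, i₂, h, hy, fun i j => ⟨fun hc => (key _ _ h i j).1 hc, fun hc => key0 _ _ _ _ _ _ (fun h' => hc ((key _ _ h i j).2 h'))⟩, ?_⟩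
    · rw [hy]; exact rectFn_rel x i₁ i₂ h i j
    · intro i hi1 hi2 hc hc'
      have := (key _ _ h i (x i)).1 ⟨hc, hc'⟩
      rw [hE i hi1 hi2] at this
      omega

end GridCD
end

section
namespace GridCD
/-- rectangle on the collapsed torus -/
def rF (a b c d i j : ℕ) : Bool := and (cN a b i) (cN c d j)

/-- swap as a function -/
def sw (a b u : ℕ) : ℕ := cond (Nat.beq u a) b (cond (Nat.beq u b) a u)

/-- the permutation with given list of values -/
def sg (s t r v u : ℕ) : ℕ :=
  cond (Nat.beq u 0) s (cond (Nat.beq u 1) t (cond (Nat.beq u 2) r v))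

/-- total multiplicity on collapsed torus -/
def tF (σ : ℕ → ℕ) (a b c d i j : ℕ) : ℕ :=
  Nat.add (cond (rF a b (σ a) (σ b) i j) 1 0)
    (cond (rF c d (σ (sw a b c)) (σ (sw a b d)) i j) 1 0)

/-- bounded universal quantifier -/
def allB (k : ℕ) (p : ℕ → Bool) : Bool := Nat.rec true (fun m r => and (p m) r) k

/-- validity -/
def vF (k : ℕ) (σ : ℕ → ℕ) (a b c d : ℕ) : Bool :=
  and (and (not (Nat.beq a b)) (not (Nat.beq c d)))
   (and (allB k fun u => or (Nat.beq u a) (or (Nat.beq u b) (not (rF a b (σ a) (σ b) u (σ u)))))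
    (allB k fun u => or (Nat.beq u c) (or (Nat.beq u d)
      (not (rF c d (σ (sw a b c)) (σ (sw a b d)) u (σ (sw a b u)))))))

/-- same total -/
def eF (k : ℕ) (σ : ℕ → ℕ) (a b c d a' b' c' d' : ℕ) : Bool :=
  allB k fun i => allB k fun j => Nat.beq (tF σ a b c d i j) (tF σ a' b' c' d' i j)

/-- valid and same total -/
def gF (k : ℕ) (σ : ℕ → ℕ) (a b c d a' b' c' d' : ℕ) : Bool :=
  and (vF k σ a' b' c' d') (eF k σ a b c d a' b' c' d')

/-- pairwise distinct -/
def dist4 (a b c d : ℕ) : Bool := and (not (Nat.beq a b)) (and (not (Nat.beq a c))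
  (and (not (Nat.beq a d)) (and (not (Nat.beq b c)) (and (not (Nat.beq b d)) (not (Nat.beq c d))))))

/-- bounded existential quantifier -/
def exB (k : ℕ) (p : ℕ → Bool) : Bool := Nat.rec false (fun m r => or (p m) r) k

/-- equality of quadruples -/
def eq4 (a b c d a' b' c' d' : ℕ) : Bool :=
  and (Nat.beq a a') (and (Nat.beq b b') (and (Nat.beq c c') (Nat.beq d d')))

/-- all indices are covered -/
def covF (k a b c d : ℕ) : Bool :=
  allB k fun u => or (Nat.beq u a) (or (Nat.beq u b) (or (Nat.beq u c) (Nat.beq u d)))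

/-- exactly one other decomposition -/
def chk (k : ℕ) (σ : ℕ → ℕ) (a b c d : ℕ) : Bool :=
  exB k fun a' => exB k fun b' => and (not (Nat.beq a' b')) <| exB k fun c' => exB k fun d' =>
    and (covF k a' b' c' d') <| and (not (eq4 a b c d a' b' c' d')) <|
    and (gF k σ a b c d a' b' c' d') <|
    allB k fun a₂ => allB k fun b₂ => cond (not (Nat.beq a₂ b₂))
      (allB k fun c₂ => allB k fun d₂ => cond (not (Nat.beq c₂ d₂))
      (cond (covF k a₂ b₂ c₂ d₂) (cond (gF k σ a b c d a₂ b₂ c₂ d₂)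
        (or (eq4 a₂ b₂ c₂ d₂ a b c d) (eq4 a₂ b₂ c₂ d₂ a' b' c' d')) true) true) true) true

theorem dec3 : (allB 3 fun s => allB 3 fun t => allB 3 fun r => 
    cond (dist4 s t r 3)
      (allB 3 fun a => allB 3 fun b => allB 3 fun c => allB 3 fun d =>
        cond (covF 3 a b c d)
          (cond (vF 3 (sg s t r 0) a b c d) (chk 3 (sg s t r 0) a b c d) true) true)
      true) = true := by
  decide +kernel

theorem dec4 : (allB 4 fun s => allB 4 fun t => allB 4 fun r => allB 4 fun v =>
    cond (dist4 s t r v)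
      (allB 4 fun a => allB 4 fun b => allB 4 fun c => allB 4 fun d =>
        cond (covF 4 a b c d)
          (cond (vF 4 (sg s t r v) a b c d) (chk 4 (sg s t r v) a b c d) true) true)
      true) = true := by
  decide +kernel

theorem beq_false_iff (a b : ℕ) : Nat.beq a b = false ↔ a ≠ b := by
  rw [← Bool.not_eq_true, Nat.beq_eq]

theorem allB_iff (k : ℕ) (p : ℕ → Bool) : allB k p = true ↔ ∀ u < k, p u = true := by
  induction k with
  | zero => simp [allB]
  | succ m ih =>
    have : allB (m + 1) p = (p m && allB m p) := rfl
    rw [this, Bool.and_eq_true, ih, Nat.forall_lt_succ_right, and_comm]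

theorem exB_iff (k : ℕ) (p : ℕ → Bool) : exB k p = true ↔ ∃ u < k, p u = true := by
  induction k with
  | zero => simp [exB]
  | succ m ih =>
    have : exB (m + 1) p = (p m || exB m p) := rfl
    rw [this, Bool.or_eq_true, ih, Nat.exists_lt_succ_right, or_comm]

theorem cond_true_iff (p q : Bool) : cond p q true = true ↔ (p = true → q = true) := by
  cases p <;> simp

/-- Combinatorial core, on the collapsed torus. -/
theorem two_core (k : ℕ) (σ : ℕ → ℕ) (hk : k = 3 ∨ k = 4) (hσ : ∀ u < k, σ u < k)
    (hinj : ∀ u < k, ∀ v < k, σ u = σ v → u = v) 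
    (hσ' : ∃ s t r v, σ = sg s t r v ∧ (k = 3 → v = 0)) 
    (a b c d : ℕ) (ha : a < k) (hb : b < k) (hc : c < k) (hd : d < k)
    (hcov : covF k a b c d = true) (hv : vF k σ a b c d = true) : chk k σ a b c d = true := by
  obtain ⟨s, t, r, v, rfl, hv0⟩ := hσ'
  rcases hk with rfl | rfl
  · obtain rfl := hv0 rfl
    have := dec3
    simp only [allB_iff, cond_true_iff] at this
    have h0 : s < _ := hσ 0 (by norm_num)
    have h1 : t < _ := hσ 1 (by norm_num)
    have h2 : r < _ := hσ 2 (by norm_num)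
    have i1 : s = t → (0 : ℕ) = 1 := hinj 0 (by norm_num) 1 (by norm_num)
    have i2 : s = r → (0 : ℕ) = 2 := hinj 0 (by norm_num) 2 (by norm_num)
    have i3 : t = r → (1 : ℕ) = 2 := hinj 1 (by norm_num) 2 (by norm_num)
    exact this s h0 t h1 r h2 (by simp only [dist4, Bool.and_eq_true, Bool.not_eq_true', beq_false_iff]; omega) a ha b hb c hc d hd hcov hv
  · have := dec4
    simp only [allB_iff, cond_true_iff] at this
    have h0 : s < _ := hσ 0 (by norm_num)
    have h1 : t < _ := hσ 1 (by norm_num)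
    have h2 : r < _ := hσ 2 (by norm_num)
    have h3 : v < _ := hσ 3 (by norm_num)
    have i1 : s = t → (0 : ℕ) = 1 := hinj 0 (by norm_num) 1 (by norm_num)
    have i2 : s = r → (0 : ℕ) = 2 := hinj 0 (by norm_num) 2 (by norm_num)
    have i3 : t = r → (1 : ℕ) = 2 := hinj 1 (by norm_num) 2 (by norm_num)
    have i4 : s = v → (0 : ℕ) = 3 := hinj 0 (by norm_num) 3 (by norm_num)
    have i5 : t = v → (1 : ℕ) = 3 := hinj 1 (by norm_num) 3 (by norm_num)
    have i6 : r = v → (2 : ℕ) = 3 := hinj 2 (by norm_num) 3 (by norm_num)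
    exact this s h0 t h1 r h2 v h3 (by simp only [dist4, Bool.and_eq_true, Bool.not_eq_true', beq_false_iff]; omega) a ha b hb c hc d hd hcov hv

end GridCD
end

section
namespace GridCD
set_option linter.unusedSectionVars false
variable {n : ℕ} [NeZero n]

theorem cN_mono (g : ℕ → ℕ) (k : ℕ) (hg : ∀ u < k, ∀ v < k, u < v → g u < g v) (u v w : ℕ)
    (hu : u < k) (hv : v < k) (hw : w < k) : cN (g u) (g v) (g w) = cN u v w := by
  have key : ∀ u < k, ∀ v < k, (g u < g v ↔ u < v) := by
    intro u hu v hv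
    constructor
    · intro h
      by_contra h'
      rcases Nat.lt_or_ge v u with h1 | h1
      · have := hg v hv u hu h1; omega
      · have : u = v := by omega
        subst this; omega
    · exact hg u hu v hv
  have key' : ∀ u < k, ∀ v < k, (g u ≤ g v ↔ u ≤ v) := by
    intro u hu v hv
    have := key v hv u hu
    omega
  simp only [cN_def, key u hu v hv, key' u hu w hw, key w hw v hv]

theorem collapse (U : Finset (ZMod n)) (k : ℕ) (hU : U.card = k) (hk : 0 < k) :
    ∃ e : ℕ → ZMod n, (∀ u < k, e u ∈ U) ∧ (∀ i ∈ U, ∃ u < k, e u = i) ∧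
      (∀ u < k, ∀ v < k, u < v → (e u).val < (e v).val) ∧
      ∀ i : ZMod n, ∃ w < k, ∀ u < k, ∀ v < k, u ≠ v →
        cN (e u).val (e v).val i.val = cN u v w := by
  classical
  have hc : (U.image ZMod.val).card = k := by
    rw [Finset.card_image_of_injective _ (ZMod.val_injective n), hU]
  let o := (U.image ZMod.val).orderEmbOfFin hc
  have ho : ∀ u, ∃ i ∈ U, i.val = o u := by
    intro u
    have := (U.image ZMod.val).orderEmbOfFin_mem hc u
    exact Finset.mem_image.1 this
  choose e' he' he'' using ho
  let e : ℕ → ZMod n := fun u => if h : u < k then e' ⟨u, h⟩ else 0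
  have hmono : ∀ u < k, ∀ v < k, u < v → (e u).val < (e v).val := by
    intro u hu v hv huv
    simp only [e, hu, hv, dif_pos, he'']
    exact o.strictMono (by simpa using huv)
  refine ⟨e, ?_, ?_, hmono, ?_⟩
  · intro u hu
    simp only [e, hu, dif_pos]; exact he' _
  · intro i hi
    have h1 : i.val ∈ Set.range o := by
      rw [Finset.range_orderEmbOfFin]
      simpa using ⟨i, hi, rfl⟩
    obtain ⟨u, hu⟩ := h1
    refine ⟨u.1, u.2, ZMod.val_injective n ?_⟩
    simp only [e, u.2, dif_pos, he'']; exact hu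
  · intro i
    by_cases hex : ∃ w, w < k ∧ (e w).val ≤ i.val
    · let w := Nat.findGreatest (fun w => w < k ∧ (e w).val ≤ i.val) k
      obtain ⟨w0, hw0⟩ := hex
      have hw : w < k ∧ (e w).val ≤ i.val :=
        Nat.findGreatest_spec (P := fun w => w < k ∧ (e w).val ≤ i.val) (le_of_lt hw0.1) hw0
      have hmax : ∀ u < k, (e u).val ≤ i.val → u ≤ w := fun u hu h =>
        Nat.le_findGreatest (P := fun w => w < k ∧ (e w).val ≤ i.val) hu.le ⟨hu, h⟩
      have hiff : ∀ u < k, ((e u).val ≤ i.val ↔ u ≤ w) := by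
        intro u hu
        refine ⟨hmax u hu, fun h => ?_⟩
        rcases Nat.lt_or_ge u w with h1 | h1
        · have := hmono u hu w hw.1 h1; omega
        · have : u = w := by omega
          rw [this]; exact hw.2
      refine ⟨w, hw.1, fun u hu v hv huv => ?_⟩
      have a1 := hiff u hu
      have a2 := hiff v hv
      have a3 := hmono u hu v hv
      have a4 := hmono v hv u hu
      simp only [cN_def]
      rcases Nat.lt_or_gt_of_ne huv with h | h
      · have := a3 h
        rw [if_pos h, if_pos this, Bool.eq_iff_iff]; simp; omega
      · have := a4 h
        rw [if_neg (by omega), if_neg (by omega), Bool.eq_iff_iff]; simp; omega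
    · push Not at hex
      refine ⟨k - 1, by omega, fun u hu v hv huv => ?_⟩
      have a1 := hex u hu
      have a2 := hex v hv
      have a3 := hmono u hu v hv
      have a4 := hmono v hv u hu
      simp only [cN_def]
      rcases Nat.lt_or_gt_of_ne huv with h | h
      · have := a3 h
        rw [if_pos h, if_pos this, Bool.eq_iff_iff]; simp; omega
      · have := a4 h
        rw [if_neg (by omega), if_neg (by omega), Bool.eq_iff_iff]; simp; omega

/-- validity of a pair of rectangles -/
def Val (x : Equiv.Perm (ZMod n)) (a b c d : ZMod n) : Prop :=
  a ≠ b ∧ c ≠ d ∧ (∀ u, u ≠ a → u ≠ b → rectFn a b (x a) (x b) u (x u) = 0) ∧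
  (∀ u, u ≠ c → u ≠ d → rectFn c d ((x * Equiv.swap a b) c) ((x * Equiv.swap a b) d) u
    ((x * Equiv.swap a b) u) = 0)

/-- total -/
def Tot (x : Equiv.Perm (ZMod n)) (a b c d : ZMod n) : ZMod n → ZMod n → ℤ :=
  rectFn a b (x a) (x b) + rectFn c d ((x * Equiv.swap a b) c) ((x * Equiv.swap a b) d)

theorem Tot_rel (x : Equiv.Perm (ZMod n)) (a b c d : ZMod n) (hab : a ≠ b) (hcd : c ≠ d)
    (i j : ZMod n) :
    Tot x a b c d i j - Tot x a b c d (i - 1) j - Tot x a b c d i (j - 1)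
      + Tot x a b c d (i - 1) (j - 1) = (if x i = j then 1 else 0) -
       (if (x * Equiv.swap a b * Equiv.swap c d) i = j then 1 else 0) := by
  have h1 := rectFn_rel x a b hab i j
  have h2 := rectFn_rel (x * Equiv.swap a b) c d hcd i j
  simp only [Tot, Pi.add_apply]
  linarith

theorem Tot_perm (x : Equiv.Perm (ZMod n)) (a b c d a' b' c' d' : ZMod n) (hab : a ≠ b)
    (hcd : c ≠ d) (hab' : a' ≠ b') (hcd' : c' ≠ d') (h : Tot x a b c d = Tot x a' b' c' d') :
    Equiv.swap a b * Equiv.swap c d = Equiv.swap a' b' * Equiv.swap c' d' := by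
  ext1 i
  have h1 := Tot_rel x a b c d hab hcd i ((x * Equiv.swap a b * Equiv.swap c d) i)
  have h2 := Tot_rel x a' b' c' d' hab' hcd' i ((x * Equiv.swap a b * Equiv.swap c d) i)
  rw [h, h2] at h1
  have : (x * Equiv.swap a' b' * Equiv.swap c' d') i = (x * Equiv.swap a b * Equiv.swap c d) i := by
    by_contra hne
    rw [if_neg hne] at h1
    simp at h1
    omega
  have := x.injective (by simpa [Equiv.Perm.mul_apply] using this)
  simp [Equiv.Perm.mul_apply, this]

theorem swap_supp {α : Type*} [DecidableEq α] (a b c d : α) (hab : a ≠ b) (hcd : c ≠ d)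
    (h1 : ¬ (c = a ∧ d = b)) (h2 : ¬ (c = b ∧ d = a)) (u : α) :
    (Equiv.swap a b * Equiv.swap c d) u ≠ u ↔ (u = a ∨ u = b ∨ u = c ∨ u = d) := by
  simp only [Equiv.Perm.mul_apply, Equiv.swap_apply_def]
  grind

theorem swap_one {α : Type*} [DecidableEq α] (a b c d : α)
    (h : (c = a ∧ d = b) ∨ (c = b ∧ d = a)) :
    Equiv.swap a b * Equiv.swap c d = 1 := by
  rcases h with ⟨rfl, rfl⟩ | ⟨rfl, rfl⟩
  · simp
  · rw [Equiv.swap_comm c d]; simp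

theorem card_quad {α : Type*} [DecidableEq α] (a b c d : α) (hab : a ≠ b) (hcd : c ≠ d)
    (h1 : ¬ (c = a ∧ d = b)) (h2 : ¬ (c = b ∧ d = a)) :
    ({a, b, c, d} : Finset α).card = 3 ∨ ({a, b, c, d} : Finset α).card = 4 := by
  by_cases ca : c = a
  · subst ca
    have : ({c, b, c, d} : Finset α) = {c, b, d} := by ext; simp; tauto
    left; rw [this, Finset.card_eq_three]
    exact ⟨c, b, d, hab, hcd, by tauto, rfl⟩
  by_cases cb : c = b
  · subst cb
    have : ({a, c, c, d} : Finset α) = {a, c, d} := by ext; simp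
    left; rw [this, Finset.card_eq_three]
    exact ⟨a, c, d, hab, by tauto, hcd, rfl⟩
  by_cases da : d = a
  · subst da
    have : ({d, b, c, d} : Finset α) = {d, b, c} := by ext; simp; tauto
    left; rw [this, Finset.card_eq_three]
    exact ⟨d, b, c, hab, Ne.symm hcd, Ne.symm cb, rfl⟩
  by_cases db : d = b
  · subst db
    have : ({a, d, c, d} : Finset α) = {a, d, c} := by ext; simp; tauto
    left; rw [this, Finset.card_eq_three]
    exact ⟨a, d, c, hab, Ne.symm ca, Ne.symm hcd, rfl⟩
  right
  rw [Finset.card_insert_of_notMem, Finset.card_insert_of_notMem, Finset.card_insert_of_notMem,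
    Finset.card_singleton] <;> simp <;> tauto

end GridCD
end

section
namespace GridCD
set_option linter.unusedSectionVars false
variable {n : ℕ} [NeZero n]

theorem sw_lt (k a b u : ℕ) (ha : a < k) (hb : b < k) (hu : u < k) : sw a b u < k := by
  unfold sw
  cases Nat.beq u a <;> cases Nat.beq u b <;> simp [*]

theorem sw_spec (k : ℕ) (e : ℕ → ZMod n) (hinj : ∀ u < k, ∀ v < k, e u = e v → u = v)
    (a b u : ℕ) (ha : a < k) (hb : b < k) (hu : u < k) :
    Equiv.swap (e a) (e b) (e u) = e (sw a b u) := by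
  unfold sw
  by_cases h1 : u = a
  · subst h1
    have : Nat.beq u u = true := by simp
    simp
  · have e1 : Nat.beq u a = false := (beq_false_iff _ _).2 h1
    by_cases h2 : u = b
    · subst h2
      simp [e1]
    · have e2 : Nat.beq u b = false := (beq_false_iff _ _).2 h2
      rw [Equiv.swap_apply_of_ne_of_ne (fun h => h1 (hinj _ hu _ ha h))
        (fun h => h2 (hinj _ hu _ hb h)), e1, e2]
      rfl

theorem sw_ne (a b c d : ℕ) (h : c ≠ d) : sw a b c ≠ sw a b d := by
  have sw_def : ∀ u, sw a b u = if u = a then b else if u = b then a else u := by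
    intro u; simp only [sw, cond_eq_ite, Nat.beq_eq]
  rw [sw_def, sw_def]
  grind

theorem two_torus (x : Equiv.Perm (ZMod n)) (a b c d : ZMod n) (hV : Val x a b c d)
    (hn1 : ¬ (c = a ∧ d = b)) (hn2 : ¬ (c = b ∧ d = a)) :
    ∃ a' b' c' d', Val x a' b' c' d' ∧ Tot x a b c d = Tot x a' b' c' d' ∧
      ¬ (a' = a ∧ b' = b ∧ c' = c ∧ d' = d) ∧
      ∀ a₂ b₂ c₂ d₂, Val x a₂ b₂ c₂ d₂ → Tot x a b c d = Tot x a₂ b₂ c₂ d₂ →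
        (a₂ = a ∧ b₂ = b ∧ c₂ = c ∧ d₂ = d) ∨ (a₂ = a' ∧ b₂ = b' ∧ c₂ = c' ∧ d₂ = d') := by
  classical
  have hk' := card_quad a b c d hV.1 hV.2.1 hn1 hn2
  have hsupp := swap_supp a b c d hV.1 hV.2.1 hn1 hn2
  set U : Finset (ZMod n) := {a, b, c, d} with hUdef
  have hUmem : ∀ u, u ∈ U ↔ (u = a ∨ u = b ∨ u = c ∨ u = d) := by intro u; simp [hUdef]
  obtain ⟨k, hk⟩ : ∃ k, U.card = k := ⟨_, rfl⟩
  rw [hk] at hk'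
  have hkpos : 0 < k := by omega
  obtain ⟨e, heU, heS, heM, heC⟩ := collapse U k hk hkpos
  have hk2 : (U.image x).card = k := by
    rw [Finset.card_image_of_injective _ x.injective, hk]
  obtain ⟨f, hfU, hfS, hfM, hfC⟩ := collapse (U.image x) k hk2 hkpos
  have einj : ∀ u < k, ∀ v < k, e u = e v → u = v := by
    intro u hu v hv h
    have := heM u hu v hv
    have := heM v hv u hu
    rw [h] at *
    omega
  have finj : ∀ u < k, ∀ v < k, f u = f v → u = v := by
    intro u hu v hv h
    have := hfM u hu v hv
    have := hfM v hv u hu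
    rw [h] at *
    omega
  have hσ0 : ∀ u, ∃ v, u < k → v < k ∧ f v = x (e u) := by
    intro u
    by_cases hu : u < k
    · obtain ⟨v, hv, h⟩ := hfS (x (e u)) (Finset.mem_image_of_mem _ (heU u hu))
      exact ⟨v, fun _ => ⟨hv, h⟩⟩
    · exact ⟨0, fun h => absurd h hu⟩
  choose σ₀ hσ₀ using hσ0
  obtain ⟨σ, hσsg, hσ⟩ : ∃ σ : ℕ → ℕ, (∃ s t r v, σ = sg s t r v ∧ (k = 3 → v = 0)) ∧
      ∀ u < k, σ u < k ∧ f (σ u) = x (e u) := by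
    refine ⟨sg (σ₀ 0) (σ₀ 1) (σ₀ 2) (if k = 3 then 0 else σ₀ 3), ⟨_, _, _, _, rfl, fun h => if_pos h⟩, ?_⟩
    intro u hu
    rcases hk' with rfl | rfl
    · interval_cases u
      · exact hσ₀ 0 hu
      · exact hσ₀ 1 hu
      · exact hσ₀ 2 hu
    · interval_cases u
      · exact hσ₀ 0 hu
      · exact hσ₀ 1 hu
      · exact hσ₀ 2 hu
      · exact hσ₀ 3 hu
  have hσlt : ∀ u < k, σ u < k := fun u hu => (hσ u hu).1
  have hσf : ∀ u < k, x (e u) = f (σ u) := fun u hu => (hσ u hu).2.symm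
  have σinj : ∀ u < k, ∀ v < k, σ u = σ v → u = v := by
    intro u hu v hv h
    apply einj u hu v hv
    apply x.injective
    rw [hσf u hu, hσf v hv, h]
  have hxs : ∀ a b u, a < k → b < k → u < k →
      (x * Equiv.swap (e a) (e b)) (e u) = f (σ (sw a b u)) := by
    intro a b u ha hb hu
    rw [Equiv.Perm.mul_apply, sw_spec k e einj a b u ha hb hu, hσf _ (sw_lt k a b u ha hb hu)]
  -- collapse maps
  choose φ hφk hφ using heC
  choose ψ hψk hψ using hfC
  have rect_gen : ∀ p q s t, p < k → q < k → s < k → t < k → p ≠ q → s ≠ t → ∀ i j,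
      rectFn (e p) (e q) (f s) (f t) i j = cond (rF p q s t (φ i) (ψ j)) 1 0 := by
    intro p q s t hp hq hs ht hpq hst i j
    unfold rectFn ind rF
    rw [hφ i p hp q hq hpq, hψ j s hs t ht hst]
    cases cN p q (φ i) <;> cases cN s t (ψ j) <;> simp
  have rect_pt : ∀ p q s t, p < k → q < k → s < k → t < k → ∀ u v, u < k → v < k → 
      rectFn (e p) (e q) (f s) (f t) (e u) (f v) = cond (rF p q s t u v) 1 0 := by
    intro p q s t hp hq hs ht u v hu hv
    unfold rectFn ind rF
    rw [cN_mono (fun u => (e u).val) k heM p q u hp hq hu,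
      cN_mono (fun u => (f u).val) k hfM s t v hs ht hv]
    cases cN p q u <;> cases cN s t v <;> simp
  have tot_gen : ∀ a b c d, a < k → b < k → c < k → d < k → a ≠ b → c ≠ d → ∀ i j,
      Tot x (e a) (e b) (e c) (e d) i j = (tF σ a b c d (φ i) (ψ j) : ℕ) := by
    intro a b c d ha hb hc hd hab hcd i j
    simp only [Tot, Pi.add_apply]
    rw [hxs a b c ha hb hc, hxs a b d ha hb hd, hσf a ha, hσf b hb]
    rw [rect_gen a b _ _ ha hb (hσlt a ha) (hσlt b hb) hab (fun h => hab (σinj a ha b hb h)),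
      rect_gen c d _ _ hc hd (hσlt _ (sw_lt k a b c ha hb hc)) (hσlt _ (sw_lt k a b d ha hb hd)) hcd
        (fun h => sw_ne a b c d hcd
          (σinj _ (sw_lt k a b c ha hb hc) _ (sw_lt k a b d ha hb hd) h))]
    unfold tF
    cases rF a b (σ a) (σ b) (φ i) (ψ j) <;>
    cases rF c d (σ (sw a b c)) (σ (sw a b d)) (φ i) (ψ j) <;> simp
  have tot_pt : ∀ a b c d, a < k → b < k → c < k → d < k → ∀ u v, u < k → v < k →
      Tot x (e a) (e b) (e c) (e d) (e u) (f v) = (tF σ a b c d u v : ℕ) := by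
    intro a b c d ha hb hc hd u v hu hv
    simp only [Tot, Pi.add_apply]
    rw [hxs a b c ha hb hc, hxs a b d ha hb hd, hσf a ha, hσf b hb]
    rw [rect_pt a b _ _ ha hb (hσlt a ha) (hσlt b hb) u v hu hv,
      rect_pt c d _ _ hc hd (hσlt _ (sw_lt k a b c ha hb hc)) (hσlt _ (sw_lt k a b d ha hb hd)) u v hu hv]
    unfold tF
    cases rF a b (σ a) (σ b) u v <;>
    cases rF c d (σ (sw a b c)) (σ (sw a b d)) u v <;> simp
  have eF_iff : ∀ a b c d a' b' c' d', a < k → b < k → c < k → d < k → a' < k → b' < k → c' < k →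
      d' < k → a ≠ b → c ≠ d → a' ≠ b' → c' ≠ d' → (eF k σ a b c d a' b' c' d' = true ↔
      Tot x (e a) (e b) (e c) (e d) = Tot x (e a') (e b') (e c') (e d')) := by
    intro a b c d a' b' c' d' ha hb hc hd ha' hb' hc' hd' hab hcd hab' hcd'
    simp only [eF, allB_iff, Nat.beq_eq]
    constructor
    · intro h
      funext i j
      rw [tot_gen a b c d ha hb hc hd hab hcd, tot_gen a' b' c' d' ha' hb' hc' hd' hab' hcd',
        h _ (hφk i) _ (hψk j)]
    · intro h u hu v hv
      have := congrFun (congrFun h (e u)) (f v)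
      rw [tot_pt a b c d ha hb hc hd u v hu hv, tot_pt a' b' c' d' ha' hb' hc' hd' u v hu hv] at this
      exact_mod_cast this
  have vF_iff : ∀ a b c d, a < k → b < k → c < k → d < k → (Val x (e a) (e b) (e c) (e d) ↔
      vF k σ a b c d = true ∧ ∀ p, p ∉ U → Tot x (e a) (e b) (e c) (e d) p (x p) = 0) := by
    intro a b c d ha hb hc hd
    simp only [vF, allB_iff, Bool.and_eq_true, Bool.not_eq_true', beq_false_iff, Bool.or_eq_true,
      Nat.beq_eq]
    have hne : ∀ p, p ∉ U → ∀ u < k, p ≠ e u := fun p hp u hu h => hp (h ▸ heU u hu)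
    constructor
    · rintro ⟨h1, h2, h3, h4⟩
      refine ⟨⟨⟨fun h => h1 (h ▸ rfl), fun h => h2 (h ▸ rfl)⟩, ?_, ?_⟩, ?_⟩
      · intro u hu
        by_cases ua : u = a
        · exact Or.inl ua
        by_cases ub : u = b
        · exact Or.inr (Or.inl ub)
        have := h3 (e u) (fun h => ua (einj _ hu _ ha h)) (fun h => ub (einj _ hu _ hb h))
        rw [hσf a ha, hσf b hb, hσf u hu,
          rect_pt a b _ _ ha hb (hσlt a ha) (hσlt b hb) u _ hu (hσlt u hu)] at this
        refine Or.inr (Or.inr ?_)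
        revert this
        cases rF a b (σ a) (σ b) u (σ u) <;> simp
      · intro u hu
        by_cases uc : u = c
        · exact Or.inl uc
        by_cases ud : u = d
        · exact Or.inr (Or.inl ud)
        have := h4 (e u) (fun h => uc (einj _ hu _ hc h)) (fun h => ud (einj _ hu _ hd h))
        rw [hxs a b c ha hb hc, hxs a b d ha hb hd, hxs a b u ha hb hu,
          rect_pt c d _ _ hc hd (hσlt _ (sw_lt k a b c ha hb hc)) (hσlt _ (sw_lt k a b d ha hb hd))
            u _ hu (hσlt _ (sw_lt k a b u ha hb hu))] at this
        refine Or.inr (Or.inr ?_)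
        revert this
        cases rF c d (σ (sw a b c)) (σ (sw a b d)) u (σ (sw a b u)) <;> simp
      · intro p hp
        have t1 := h3 p (hne p hp a ha) (hne p hp b hb)
        have t2 := h4 p (hne p hp c hc) (hne p hp d hd)
        rw [show (x * Equiv.swap (e a) (e b)) p = x p by
          rw [Equiv.Perm.mul_apply, Equiv.swap_apply_of_ne_of_ne (hne p hp a ha) (hne p hp b hb)]] at t2
        simp only [Tot, Pi.add_apply, t1, t2, add_zero]
    · rintro ⟨⟨⟨h1, h2⟩, h3, h4⟩, h5⟩
      refine ⟨fun h => h1 (einj _ ha _ hb h), fun h => h2 (einj _ hc _ hd h), ?_, ?_⟩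
      · intro p pa pb
        by_cases hp : p ∈ U
        · obtain ⟨u, hu, rfl⟩ := heS p hp
          rw [hσf a ha, hσf b hb, hσf u hu,
            rect_pt a b _ _ ha hb (hσlt a ha) (hσlt b hb) u _ hu (hσlt u hu)]
          rcases h3 u hu with h | h | h
          · exact absurd (h ▸ rfl) pa
          · exact absurd (h ▸ rfl) pb
          · rw [h]; rfl
        · have := h5 p hp
          simp only [Tot, Pi.add_apply] at this
          have g1 := rectFn_nonneg (e a) (e b) (x (e a)) (x (e b)) p (x p)
          have g2 := rectFn_nonneg (e c) (e d) ((x * Equiv.swap (e a) (e b)) (e c))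
            ((x * Equiv.swap (e a) (e b)) (e d)) p (x p)
          linarith
      · intro p pc pd
        by_cases hp : p ∈ U
        · obtain ⟨u, hu, rfl⟩ := heS p hp
          rw [hxs a b c ha hb hc, hxs a b d ha hb hd, hxs a b u ha hb hu,
            rect_pt c d _ _ hc hd (hσlt _ (sw_lt k a b c ha hb hc)) (hσlt _ (sw_lt k a b d ha hb hd))
              u _ hu (hσlt _ (sw_lt k a b u ha hb hu))]
          rcases h4 u hu with h | h | h
          · exact absurd (h ▸ rfl) pc
          · exact absurd (h ▸ rfl) pd
          · rw [h]; rfl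
        · have := h5 p hp
          rw [show (x * Equiv.swap (e a) (e b)) p = x p by
            rw [Equiv.Perm.mul_apply,
              Equiv.swap_apply_of_ne_of_ne (hne p hp a ha) (hne p hp b hb)]]
          simp only [Tot, Pi.add_apply] at this
          have g1 := rectFn_nonneg (e a) (e b) (x (e a)) (x (e b)) p (x p)
          have g2 := rectFn_nonneg (e c) (e d) ((x * Equiv.swap (e a) (e b)) (e c))
            ((x * Equiv.swap (e a) (e b)) (e d)) p (x p)
          linarith
  have cov_of : ∀ a b c d, (∀ u ∈ U, u = e a ∨ u = e b ∨ u = e c ∨ u = e d) → a < k → b < k →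
      c < k → d < k → covF k a b c d = true := by
    intro a b c d h ha hb hc hd
    simp only [covF, allB_iff, Bool.or_eq_true, Nat.beq_eq]
    intro u hu
    rcases h (e u) (heU u hu) with h | h | h | h
    · exact Or.inl (einj _ hu _ ha h)
    · exact Or.inr (Or.inl (einj _ hu _ hb h))
    · exact Or.inr (Or.inr (Or.inl (einj _ hu _ hc h)))
    · exact Or.inr (Or.inr (Or.inr (einj _ hu _ hd h)))
  clear_value U
  obtain ⟨a, ha, rfl⟩ := heS a ((hUmem a).2 (by simp))
  obtain ⟨b, hb, rfl⟩ := heS b ((hUmem b).2 (by simp))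
  obtain ⟨c, hc, rfl⟩ := heS c ((hUmem c).2 (by simp))
  obtain ⟨d, hd, rfl⟩ := heS d ((hUmem d).2 (by simp))
  have hvv := (vF_iff a b c d ha hb hc hd).1 hV
  have hcov := cov_of a b c d (fun u hu => (hUmem u).1 hu) ha hb hc hd
  have hchk := two_core k σ hk' hσlt σinj hσsg a b c d ha hb hc hd hcov hvv.1
  have hab : a ≠ b := fun h => hV.1 (h ▸ rfl)
  have hcd : c ≠ d := fun h => hV.2.1 (h ▸ rfl)
  simp only [chk, exB_iff, allB_iff, Bool.and_eq_true, Bool.not_eq_true', cond_true_iff,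
    beq_false_iff, gF] at hchk
  obtain ⟨a', ha', b', hb', hab', c', hc', d', hd', hcov', hneq, ⟨hv', he'⟩, huniq⟩ := hchk
  have hcd' : c' ≠ d' := by
    simp only [vF, Bool.and_eq_true, Bool.not_eq_true', beq_false_iff] at hv'
    exact hv'.1.2
  have hT := (eF_iff a b c d a' b' c' d' ha hb hc hd ha' hb' hc' hd' hab hcd hab' hcd').1 he'
  refine ⟨e a', e b', e c', e d', (vF_iff a' b' c' d' ha' hb' hc' hd').2 ⟨hv', ?_⟩, hT, ?_, ?_⟩
  · rw [← hT]; exact hvv.2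
  · rintro ⟨h1, h2, h3, h4⟩
    have h1 := einj _ ha' _ ha h1
    have h2 := einj _ hb' _ hb h2
    have h3 := einj _ hc' _ hc h3
    have h4 := einj _ hd' _ hd h4
    subst h1 h2 h3 h4
    simp [eq4] at hneq
  · intro a₂ b₂ c₂ d₂ hV2 hT2
    have hperm := Tot_perm x _ _ _ _ _ _ _ _ hV.1 hV.2.1 hV2.1 hV2.2.1 hT2
    have hnp : ¬ ((c₂ = a₂ ∧ d₂ = b₂) ∨ (c₂ = b₂ ∧ d₂ = a₂)) := by
      intro h
      rw [swap_one _ _ _ _ h] at hperm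
      have := (hsupp (e a)).2 (Or.inl rfl)
      rw [hperm] at this
      exact this rfl
    push Not at hnp
    have hs2 := swap_supp a₂ b₂ c₂ d₂ hV2.1 hV2.2.1 (fun h => hnp.1 h.1 h.2) (fun h => hnp.2 h.1 h.2)
    have hU2 : ∀ u, u ∈ U ↔ (u = a₂ ∨ u = b₂ ∨ u = c₂ ∨ u = d₂) := by
      intro u
      rw [hUmem, ← hsupp, ← hs2, hperm]
    obtain ⟨a₂, ha₂, rfl⟩ := heS a₂ ((hU2 a₂).2 (by simp))
    obtain ⟨b₂, hb₂, rfl⟩ := heS b₂ ((hU2 b₂).2 (by simp))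
    obtain ⟨c₂, hc₂, rfl⟩ := heS c₂ ((hU2 c₂).2 (by simp))
    obtain ⟨d₂, hd₂, rfl⟩ := heS d₂ ((hU2 d₂).2 (by simp))
    have hab2 : a₂ ≠ b₂ := fun h => hV2.1 (h ▸ rfl)
    have hcd2 : c₂ ≠ d₂ := fun h => hV2.2.1 (h ▸ rfl)
    have := huniq a₂ ha₂ b₂ hb₂ hab2 c₂ hc₂ d₂ hd₂ hcd2
      (cov_of _ _ _ _ (fun u hu => (hU2 u).1 hu) ha₂ hb₂ hc₂ hd₂)
      ⟨((vF_iff _ _ _ _ ha₂ hb₂ hc₂ hd₂).1 hV2).1,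
        (eF_iff _ _ _ _ _ _ _ _ ha hb hc hd ha₂ hb₂ hc₂ hd₂ hab hcd hab2 hcd2).2 hT2⟩
    simp only [eq4, Bool.or_eq_true, Bool.and_eq_true, Nat.beq_eq] at this
    rcases this with ⟨rfl, rfl, rfl, rfl⟩ | ⟨rfl, rfl, rfl, rfl⟩
    · exact Or.inl ⟨rfl, rfl, rfl, rfl⟩
    · exact Or.inr ⟨rfl, rfl, rfl, rfl⟩

end GridCD
end

section
namespace GridCD
set_option linter.unusedSectionVars false
variable {n : ℕ} [NeZero n]

theorem val_ne {a b : ZMod n} (h : a ≠ b) : a.val ≠ b.val := fun e => h (ZMod.val_injective n e)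

theorem ind_self (a b : ZMod n) (h : a ≠ b) : ind a b a = 1 := by
  have := val_ne h
  unfold ind
  rw [cN_def]
  split_ifs <;> grind

theorem ind_right (a b : ZMod n) : ind a b b = 0 ∨ a = b := by
  by_cases h : a = b
  · exact Or.inr h
  left
  have := val_ne h
  unfold ind
  rw [cN_def]
  split_ifs <;> grind

theorem ind_add_one (a b : ZMod n) (h : a ≠ b) (h' : b ≠ a + 1) : ind a b (a + 1) = 1 := by
  have h1 := val_ne h
  have h2 := val_ne h'
  have ha := ZMod.val_lt a
  have hb := ZMod.val_lt b
  rw [val_add_one] at h2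
  unfold ind
  rw [cN_def, val_add_one]
  grind

theorem ind_compl (a b i : ZMod n) (h : a ≠ b) : ind a b i + ind b a i = 1 := by
  have h1 := val_ne h
  unfold ind
  rw [cN_def, cN_def]
  grind

theorem ne_add_one {j : ZMod n} (hj : j ≠ -1) : j ≠ j + 1 := by
  intro h
  have h1 := val_ne hj
  rw [val_neg_one'] at h1
  have := congrArg ZMod.val h
  rw [val_add_one] at this
  grind

theorem ind_succ (j i : ZMod n) (hj : j ≠ j + 1) : ind j (j + 1) i = if i = j then 1 else 0 := by
  have h0 := val_ne hj
  have ha := ZMod.val_lt j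
  have hi := ZMod.val_lt i
  have e1 : i = j ↔ i.val = j.val := ⟨fun h => h ▸ rfl, fun h => ZMod.val_injective n h⟩
  rw [val_add_one] at h0
  unfold ind
  rw [cN_def, val_add_one]
  simp only [e1]
  by_cases hl : j.val = n - 1
  · rw [if_pos hl] at h0 ⊢
    grind
  · rw [if_neg hl] at h0 ⊢
    grind

theorem ind_inj (a b a' b' : ZMod n) (h : a ≠ b) (h' : a' ≠ b')
    (he : ∀ i, ind a b i = ind a' b' i) : a = a' ∧ b = b' := by
  have key : ∀ i, ((if i = a then 1 else 0) - (if i = b then 1 else 0) : ℤ) =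
      (if i = a' then 1 else 0) - (if i = b' then 1 else 0) := by
    intro i
    rw [← ind_sub a b i h, ← ind_sub a' b' i h', he, he]
  have k1 := key a
  have k2 := key b
  constructor <;> grind

theorem rectFn_inj (a b c d a' b' c' d' : ZMod n) (h : a ≠ b) (hc : c ≠ d) (h' : a' ≠ b')
    (he : rectFn a b c d = rectFn a' b' c' d') : a = a' ∧ b = b' := by
  apply ind_inj a b a' b' h h'
  have key : ∀ i, ind a b i = ind a' b' i * ind c' d' c := by
    intro i
    have := congrFun (congrFun he i) c
    simpa only [rectFn, ind_self c d hc, mul_one] using this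
  have h1 := key a
  rw [ind_self a b h] at h1
  have : ind c' d' c = 1 := by
    rcases ind_cases c' d' c with h | h
    · rw [h] at h1; simp at h1
    · exact h
  intro i
  rw [key i, this, mul_one]

/-- transpose -/
def tr (F : ZMod n → ZMod n → ℤ) : ZMod n → ZMod n → ℤ := fun i j => F j i

theorem rect_tr {x y : Equiv.Perm (ZMod n)} {R : ZMod n → ZMod n → ℤ} (h : IsGridRect n x y R) :
    IsGridRect n x⁻¹ y⁻¹ (tr R) := by
  rw [rect_iff] at h ⊢
  obtain ⟨a, b, hab, rfl, rfl, h0, hE⟩ := h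
  refine ⟨x a, x b, fun e => hab (x.injective e), ?_, ?_, h0, ?_⟩
  · rw [mul_inv_rev, Equiv.swap_inv, Equiv.swap_mul_eq_mul_swap, inv_inv]
  · funext i j
    simp [tr, rectFn, mul_comm]
  · intro i h1 h2
    have := hE (x⁻¹ i) (fun e => h1 (by rw [← e]; simp)) (fun e => h2 (by rw [← e]; simp))
    simpa [tr] using this

theorem rect_tr_iff {x y : Equiv.Perm (ZMod n)} {R : ZMod n → ZMod n → ℤ} :
    IsGridRect n x⁻¹ y⁻¹ (tr R) ↔ IsGridRect n x y R :=
  ⟨fun h => by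
    have := rect_tr h
    rw [inv_inv, inv_inv] at this
    exact this, rect_tr⟩

theorem annH_dec (x : Equiv.Perm (ZMod n)) (j : ZMod n) (hj : j ≠ -1) :
    ∃ w R S, IsGridRect n x w R ∧ IsGridRect n w x S ∧ R + S = annH n j ∧
      ∀ w' R' S', IsGridRect n x w' R' → IsGridRect n w' x S' → R' + S' = annH n j →
        w' = w ∧ R' = R ∧ S' = S := by
  have hj1 := ne_add_one hj
  set a := x.symm j with ha
  set b := x.symm (j + 1) with hb
  have xa : x a = j := by simp [ha]
  have xb : x b = j + 1 := by simp [hb]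
  have hab : a ≠ b := fun e => hj1 (xa.symm.trans ((congrArg x e).trans xb))
  refine ⟨x * Equiv.swap a b, rectFn a b j (j + 1), rectFn b a j (j + 1), ?_, ?_, ?_, ?_⟩
  · rw [rect_iff]
    refine ⟨a, b, hab, rfl, by rw [xa, xb], ?_, ?_⟩
    · simp [rectFn, ind_succ j _ hj1, hj.symm]
    · intro i h1 h2
      have : x i ≠ j := fun e => h1 (x.injective (by rw [e, xa]))
      simp [rectFn, ind_succ j _ hj1, this]
  · rw [rect_iff]
    refine ⟨b, a, hab.symm, ?_, ?_, ?_, ?_⟩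
    · rw [mul_assoc, Equiv.swap_comm b a]; simp
    · simp [xa, xb]
    · simp [rectFn, ind_succ j _ hj1, hj.symm]
    · intro i h1 h2
      have : x i ≠ j := fun e => h2 (x.injective (by rw [e, xa]))
      rw [Equiv.Perm.mul_apply, Equiv.swap_apply_of_ne_of_ne h2 h1]
      simp [rectFn, ind_succ j _ hj1, this]
  · funext i j'
    have := ind_compl a b i hab
    simp only [Pi.add_apply, rectFn, annH, ind_succ j _ hj1]
    rw [← add_mul, this, one_mul]
  · intro w' R' S' hR hS hF
    have hS0 := hS.1.2
    rw [rect_iff] at hR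
    obtain ⟨p, q, hpq, rfl, hR', -, -⟩ := hR
    have hxpq : x p ≠ x q := fun e => hpq (x.injective e)
    have hle : ∀ i j', R' i j' ≤ if j' = j then 1 else 0 := by
      intro i j'
      have := congrFun (congrFun hF i) j'
      simp only [Pi.add_apply, annH] at this
      have := hS0 i j'
      linarith
    have hp : x p = j := by
      have := hle p (x p)
      rw [hR'] at this
      simp only [rectFn, ind_self _ _ hpq, ind_self _ _ hxpq] at this
      by_contra hne
      rw [if_neg hne] at this
      norm_num at this
    have hq : x q = j + 1 := by
      by_contra hne
      have := hle p (x p + 1)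
      rw [hR'] at this
      simp only [rectFn, ind_self _ _ hpq,
        ind_add_one (x p) (x q) hxpq (by rw [hp]; exact hne)] at this
      rw [hp, if_neg (Ne.symm hj1)] at this
      norm_num at this
    have ep : p = a := x.injective (by rw [hp, xa])
    have eq : q = b := x.injective (by rw [hq, xb])
    subst ep eq
    have e1 : R' = rectFn a b j (j + 1) := by rw [hR', hp, hq]
    refine ⟨rfl, e1, ?_⟩
    have h2 : rectFn a b j (j+1) + rectFn b a j (j + 1) = annH n j := by
      funext i j'
      have := ind_compl a b i hab
      simp only [Pi.add_apply, rectFn, annH, ind_succ j _ hj1]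
      rw [← add_mul, this, one_mul]
    rw [e1, ← h2] at hF
    exact add_left_cancel hF

theorem annV_dec (x : Equiv.Perm (ZMod n)) (j : ZMod n) (hj : j ≠ -1) :
    ∃ w R S, IsGridRect n x w R ∧ IsGridRect n w x S ∧ R + S = annV n j ∧
      ∀ w' R' S', IsGridRect n x w' R' → IsGridRect n w' x S' → R' + S' = annV n j →
        w' = w ∧ R' = R ∧ S' = S := by
  have trV : annV n j = tr (annH n j) := rfl
  obtain ⟨w, R, S, hR, hS, hF, hu⟩ := annH_dec x⁻¹ j hj
  refine ⟨w⁻¹, tr R, tr S, by simpa using rect_tr hR, by simpa using rect_tr hS, ?_, ?_⟩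
  · rw [trV, ← hF]; rfl
  · intro w' R' S' hR' hS' hF'
    obtain ⟨h1, h2, h3⟩ := hu w'⁻¹ (tr R') (tr S') (rect_tr hR') (rect_tr hS')
      (by rw [show annH n j = tr (annV n j) from rfl, ← hF']; rfl)
    refine ⟨by rw [← h1, inv_inv], by rw [← h2]; rfl, by rw [← h3]; rfl⟩

theorem deg_ann (x : Equiv.Perm (ZMod n)) (a b c d : ZMod n) (hV : Val x a b c d)
    (h0 : Tot x a b c d (-1) (-1) = 0)
    (h : (c = a ∧ d = b) ∨ (c = b ∧ d = a)) :
    (∃ j, j ≠ -1 ∧ Tot x a b c d = annH n j) ∨ (∃ i, i ≠ -1 ∧ Tot x a b c d = annV n i) := by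
  obtain ⟨hab, hcd, h3, h4⟩ := hV
  have hxab : x a ≠ x b := fun e => hab (x.injective e)
  rcases h with ⟨rfl, rfl⟩ | ⟨rfl, rfl⟩
  · right
    have hT : Tot x c d c d = fun i _ => ind c d i := by
      funext i j
      simp only [Tot, Pi.add_apply, rectFn, Equiv.Perm.mul_apply, Equiv.swap_apply_left,
        Equiv.swap_apply_right]
      rw [← mul_add, ind_compl _ _ _ hxab, mul_one]
    have hd : d = c + 1 := by
      by_contra hne
      by_cases hc1 : c + 1 = c
      · exact hab (by
          have : (1 : ZMod n) = 0 := by simpa using hc1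
          have : Subsingleton (ZMod n) := subsingleton_of_zero_eq_one this.symm
          exact Subsingleton.elim _ _)
      have t1 := h3 (c + 1) hc1 (Ne.symm hne)
      have t2 := h4 (c + 1) hc1 (Ne.symm hne)
      rw [Equiv.Perm.mul_apply x _ (c + 1), Equiv.swap_apply_of_ne_of_ne hc1 (Ne.symm hne)] at t2
      have := congrFun (congrFun hT (c + 1)) (x (c + 1))
      simp only [Tot, Pi.add_apply, t1, t2, ind_add_one c d hab hne] at this
      norm_num at this
    have hc1 : c ≠ c + 1 := hd ▸ hab
    refine ⟨c, ?_, ?_⟩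
    · rintro rfl
      rw [hT] at h0
      simp only [ind_self _ _ hab] at h0
      norm_num at h0
    · rw [hT, hd]
      funext i j
      rw [ind_succ c i hc1]; rfl
  · left
    have hT : Tot x d c c d = fun _ j => ind (x d) (x c) j := by
      funext i j
      simp only [Tot, Pi.add_apply, rectFn, Equiv.Perm.mul_apply, Equiv.swap_apply_left,
        Equiv.swap_apply_right]
      rw [← add_mul, ind_compl _ _ _ hab, one_mul]
    have hd : x c = x d + 1 := by
      by_contra hne
      by_cases hc1 : x d + 1 = x d
      · exact hab (by
          have : (1 : ZMod n) = 0 := by simpa using hc1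
          have : Subsingleton (ZMod n) := subsingleton_of_zero_eq_one this.symm
          exact Subsingleton.elim _ _)
      obtain ⟨u, hu⟩ := x.surjective (x d + 1)
      have ud : u ≠ d := by rintro rfl; exact hc1 hu.symm
      have uc : u ≠ c := by rintro rfl; exact hne hu
      have t1 := h3 u ud uc
      have t2 := h4 u uc ud
      rw [Equiv.Perm.mul_apply x _ u, Equiv.swap_apply_of_ne_of_ne ud uc] at t2
      have := congrFun (congrFun hT u) (x u)
      rw [hu] at t1 t2
      simp only [Tot, Pi.add_apply, hu, t1, t2, ind_add_one (x d) (x c) hxab hne] at this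
      norm_num at this
    have hc1 : x d ≠ x d + 1 := hd ▸ hxab
    refine ⟨x d, ?_, ?_⟩
    · intro e
      rw [hT] at h0
      rw [← e] at h0
      simp only [ind_self _ _ hxab] at h0
      norm_num at h0
    · rw [hT, hd]
      funext i j
      rw [ind_succ (x d) j hc1]; rfl

end GridCD
end

section
namespace GridCD
set_option linter.unusedSectionVars false
variable {n : ℕ} [NeZero n]

open Classical in
/-- all rectangle-shaped functions -/
noncomputable def rectsF (n : ℕ) [NeZero n] : Finset (ZMod n → ZMod n → ℤ) :=
  (Finset.univ : Finset (ZMod n × ZMod n × ZMod n × ZMod n)).image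
    fun q => rectFn q.1 q.2.1 q.2.2.1 q.2.2.2

theorem rect_mem {x y : Equiv.Perm (ZMod n)} {R : ZMod n → ZMod n → ℤ} (h : IsGridRect n x y R) :
    R ∈ rectsF n := by
  rw [rect_iff] at h
  obtain ⟨a, b, -, -, rfl, -, -⟩ := h
  exact Finset.mem_image.2 ⟨(a, b, x a, x b), Finset.mem_univ _, rfl⟩

open Classical in
/-- rectangles from x to w -/
noncomputable def rects (x w : Equiv.Perm (ZMod n)) : Finset (ZMod n → ZMod n → ℤ) :=
  (rectsF n).filter (IsGridRect n x w)

theorem mem_rects {x y : Equiv.Perm (ZMod n)} {R : ZMod n → ZMod n → ℤ} :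
    R ∈ rects x y ↔ IsGridRect n x y R := by
  classical
  unfold rects
  rw [Finset.mem_filter]
  exact ⟨fun h => h.2, fun h => ⟨rect_mem h, h⟩⟩

open Classical in
/-- decompositions of F in two rectangles -/
noncomputable def decs (x z : Equiv.Perm (ZMod n)) (F : ZMod n → ZMod n → ℤ) :
    Finset (Equiv.Perm (ZMod n) × (ZMod n → ZMod n → ℤ) × (ZMod n → ZMod n → ℤ)) :=
  (Finset.univ ×ˢ rectsF n ×ˢ rectsF n).filter
    fun t => IsGridRect n x t.1 t.2.1 ∧ IsGridRect n t.1 z t.2.2 ∧ t.2.1 + t.2.2 = F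

theorem mem_decs {x z : Equiv.Perm (ZMod n)} {F : ZMod n → ZMod n → ℤ}
    {t : Equiv.Perm (ZMod n) × (ZMod n → ZMod n → ℤ) × (ZMod n → ZMod n → ℤ)} :
    t ∈ decs x z F ↔ IsGridRect n x t.1 t.2.1 ∧ IsGridRect n t.1 z t.2.2 ∧ t.2.1 + t.2.2 = F := by
  classical
  unfold decs
  rw [Finset.mem_filter]
  refine ⟨fun h => h.2, fun h => ⟨?_, h⟩⟩
  simp [rect_mem h.1, rect_mem h.2.1]

theorem dom_eq {x z : Equiv.Perm (ZMod n)} {F : ZMod n → ZMod n → ℤ}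
    (h : ∀ i j : ZMod n, F i j - F (i - 1) j - F i (j - 1) + F (i - 1) (j - 1) =
        (if x i = j then 1 else 0) - (if z i = j then 1 else 0))
    (h0 : ∀ i j : ZMod n, F i j - F (i - 1) j - F i (j - 1) + F (i - 1) (j - 1) = 0) : x = z := by
  ext1 i
  have h1 := h i (x i)
  rw [h0] at h1
  by_contra hne
  have hne' : ¬ z i = x i := fun e => hne e.symm
  simp [hne'] at h1

theorem decs_rel {x z w : Equiv.Perm (ZMod n)} {R S : ZMod n → ZMod n → ℤ}
    (hR : IsGridRect n x w R) (hS : IsGridRect n w z S) (i j : ZMod n) :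
    (R + S) i j - (R + S) (i - 1) j - (R + S) i (j - 1) + (R + S) (i - 1) (j - 1) =
        (if x i = j then 1 else 0) - (if z i = j then 1 else 0) := by
  have h1 := hR.1.1.2 i j
  have h2 := hS.1.1.2 i j
  simp only [Pi.add_apply]
  linarith

theorem annH_rel (k i j : ZMod n) : annH n k i j - annH n k (i - 1) j - annH n k i (j - 1)
    + annH n k (i - 1) (j - 1) = 0 := by
  simp only [annH]; ring

theorem annV_rel (k i j : ZMod n) : annV n k i j - annV n k (i - 1) j - annV n k i (j - 1)
    + annV n k (i - 1) (j - 1) = 0 := by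
  simp only [annV]; ring

theorem cast_sub_one : (n : ZMod n) - 1 = -1 := by simp

open Classical in
/-- the annulus weight -/
noncomputable def annC (F : ZMod n → ZMod n → ℤ) : ℤ :=
  if ∃ j, j ≠ -1 ∧ F = annH n j then 1 else if ∃ i, i ≠ -1 ∧ F = annV n i then -1 else 0

theorem annHV (j i : ZMod n) (hj : j ≠ -1) : annH n j ≠ annV n i := by
  intro h
  have h1 := congrFun (congrFun h i) (-1)
  simp only [annH, annV, if_neg (Ne.symm hj)] at h1
  simp at h1

theorem csum (sgn : SignAssignment n) (x z : Equiv.Perm (ZMod n)) (F : ZMod n → ZMod n → ℤ) :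
    ∑ t ∈ decs x z F, sgn.s x t.1 t.2.1 * sgn.s t.1 z t.2.2 = if x = z then annC F else 0 := by
  classical
  by_cases hH : ∃ j, j ≠ -1 ∧ F = annH n j
  · have hA : annC F = 1 := by unfold annC; rw [if_pos hH]
    obtain ⟨j, hj, rfl⟩ := hH
    by_cases hxz : x = z
    · subst hxz
      rw [if_pos rfl, hA]
      obtain ⟨w, R, S, hR, hS, hF, hu⟩ := annH_dec x j hj
      have : decs x x (annH n j) = {(w, R, S)} := by
        ext ⟨w', R', S'⟩
        rw [mem_decs, Finset.mem_singleton]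
        constructor
        · rintro ⟨h1, h2, h3⟩
          obtain ⟨rfl, rfl, rfl⟩ := hu w' R' S' h1 h2 h3
          rfl
        · intro h
          cases h
          exact ⟨hR, hS, hF⟩
      rw [this, Finset.sum_singleton]
      exact sgn.s_horiz x w R S j (by rwa [cast_sub_one]) hR hS hF
    · rw [if_neg hxz]
      apply Finset.sum_eq_zero
      intro t ht
      rw [mem_decs] at ht
      have := decs_rel ht.1 ht.2.1
      rw [ht.2.2] at this
      exact absurd (dom_eq this (annH_rel j)) hxz
  by_cases hV : ∃ j, j ≠ -1 ∧ F = annV n j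
  · have hA : annC F = -1 := by unfold annC; rw [if_neg hH, if_pos hV]
    obtain ⟨j, hj, rfl⟩ := hV
    by_cases hxz : x = z
    · subst hxz
      rw [if_pos rfl, hA]
      obtain ⟨w, R, S, hR, hS, hF, hu⟩ := annV_dec x j hj
      have : decs x x (annV n j) = {(w, R, S)} := by
        ext ⟨w', R', S'⟩
        rw [mem_decs, Finset.mem_singleton]
        constructor
        · rintro ⟨h1, h2, h3⟩
          obtain ⟨rfl, rfl, rfl⟩ := hu w' R' S' h1 h2 h3
          rfl
        · intro h
          cases h
          exact ⟨hR, hS, hF⟩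
      rw [this, Finset.sum_singleton]
      exact sgn.s_vert x w R S j (by rwa [cast_sub_one]) hR hS hF
    · rw [if_neg hxz]
      apply Finset.sum_eq_zero
      intro t ht
      rw [mem_decs] at ht
      have := decs_rel ht.1 ht.2.1
      rw [ht.2.2] at this
      exact absurd (dom_eq this (annV_rel j)) hxz
  have hA : annC F = 0 := by unfold annC; rw [if_neg hH, if_neg hV]
  rw [hA, ite_self]
  by_cases hne : decs x z F = ∅
  · rw [hne, Finset.sum_empty]
  obtain ⟨⟨w, R, S⟩, ht⟩ := Finset.nonempty_iff_ne_empty.2 hne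
  rw [mem_decs] at ht
  obtain ⟨hR, hS, hF⟩ := ht
  simp only at hR hS hF
  have hF0 : F (-1) (-1) = 0 := by
    have h1 := hR.1.1.1
    have h2 := hS.1.1.1
    rw [cast_sub_one] at h1 h2
    rw [← hF, Pi.add_apply, Pi.add_apply, h1, h2]; rfl
  have toV : ∀ w R S, IsGridRect n x w R → IsGridRect n w z S → R + S = F →
      ∃ a b c d, Val x a b c d ∧ Tot x a b c d = F ∧ w = x * Equiv.swap a b ∧
        R = rectFn a b (x a) (x b) ∧ 
        S = rectFn c d ((x * Equiv.swap a b) c) ((x * Equiv.swap a b) d) ∧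
        z = x * Equiv.swap a b * Equiv.swap c d := by
    intro w R S hR hS hF
    rw [rect_iff] at hR hS
    obtain ⟨a, b, hab, rfl, rfl, -, h3⟩ := hR
    obtain ⟨c, d, hcd, rfl, rfl, -, h4⟩ := hS
    exact ⟨a, b, c, d, ⟨hab, hcd, h3, h4⟩, hF, rfl, rfl, rfl, rfl⟩
  have ofV : ∀ a b c d, Val x a b c d → Tot x a b c d = F → 
      IsGridRect n x (x * Equiv.swap a b) (rectFn a b (x a) (x b)) ∧
      IsGridRect n (x * Equiv.swap a b) (x * Equiv.swap a b * Equiv.swap c d)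
        (rectFn c d ((x * Equiv.swap a b) c) ((x * Equiv.swap a b) d)) := by
    intro a b c d hV hT
    have h0 : Tot x a b c d (-1) (-1) = 0 := by rw [hT, hF0]
    have p1 := rectFn_nonneg a b (x a) (x b) (-1) (-1)
    have p2 := rectFn_nonneg c d ((x * Equiv.swap a b) c) ((x * Equiv.swap a b) d) (-1) (-1)
    simp only [Tot, Pi.add_apply] at h0
    rw [rect_iff, rect_iff]
    exact ⟨⟨a, b, hV.1, rfl, rfl, by linarith, hV.2.2.1⟩,
      ⟨c, d, hV.2.1, rfl, rfl, by linarith, hV.2.2.2⟩⟩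
  obtain ⟨a, b, c, d, hVal, hT, hw, hRr, hSr, hz⟩ := toV w R S hR hS hF
  have hdeg : ¬ ((c = a ∧ d = b) ∨ (c = b ∧ d = a)) := by
    intro h
    have := deg_ann x a b c d hVal (by rw [hT, hF0]) h
    rw [hT] at this
    exact this.elim hH hV
  obtain ⟨a', b', c', d', hVal', hTT, hdiff, huniq⟩ := two_torus x a b c d hVal
    (fun h => hdeg (Or.inl h)) (fun h => hdeg (Or.inr h))
  have hT' : Tot x a' b' c' d' = F := by rw [← hTT, hT]
  have hz' : z = x * Equiv.swap a' b' * Equiv.swap c' d' := by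
    rw [hz, mul_assoc, mul_assoc, Tot_perm x a b c d a' b' c' d' hVal.1 hVal.2.1 hVal'.1 hVal'.2.1 hTT]
  obtain ⟨hR', hS'⟩ := ofV a' b' c' d' hVal' hT'
  rw [← hz'] at hS'
  set w' := x * Equiv.swap a' b' with hw'
  set R' := rectFn a' b' (x a') (x b') with hRr'
  set S' := rectFn c' d' (w' c') (w' d') with hSr'
  have hne' : (w, R, S) ≠ (w', R', S') := by
    intro h
    simp only [Prod.mk.injEq] at h
    obtain ⟨h1, h2, h3⟩ := h
    have ab := rectFn_inj _ _ _ _ _ _ _ _ hVal.1 (fun e => hVal.1 (x.injective e)) hVal'.1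
      (hRr.symm.trans (h2.trans hRr'))
    have cd := rectFn_inj _ _ _ _ _ _ _ _ hVal.2.1
      (fun e => hVal.2.1 ((x * Equiv.swap a b).injective e)) hVal'.2.1
      (hSr.symm.trans (h3.trans hSr'))
    exact hdiff ⟨ab.1.symm, ab.2.symm, cd.1.symm, cd.2.symm⟩
  have hset : decs x z F = {(w, R, S), (w', R', S')} := by
    ext ⟨w₂, R₂, S₂⟩
    rw [mem_decs, Finset.mem_insert, Finset.mem_singleton]
    constructor
    · rintro ⟨h1, h2, h3⟩
      obtain ⟨a₂, b₂, c₂, d₂, hVal₂, hT₂, hw₂, hR₂, hS₂, hz₂⟩ := toV w₂ R₂ S₂ h1 h2 h3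
      rcases huniq a₂ b₂ c₂ d₂ hVal₂ (by rw [hT, hT₂]) with ⟨rfl, rfl, rfl, rfl⟩ | ⟨rfl, rfl, rfl, rfl⟩
      · left
        rw [hw₂, hR₂, hS₂, hw, hRr, hSr]
      · right
        rw [hw₂, hR₂, hS₂]
    · rintro (h | h)
      · cases h; exact ⟨hR, hS, hF⟩
      · cases h; exact ⟨hR', hS', hT'⟩
  rw [hset, Finset.sum_pair hne']
  have := sgn.s_square x z w w' R S R' S' hR hS hR' hS' (hF.trans hT'.symm) hne'
    (fun j hj h => hH ⟨j, by rwa [cast_sub_one] at hj, hF.symm.trans h⟩)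
    (fun j hj h => hV ⟨j, by rwa [cast_sub_one] at hj, hF.symm.trans h⟩)
  simp only
  rw [this]; ring

end GridCD
end

section
namespace GridCD
set_option linter.unusedSectionVars false
variable {n : ℕ} [NeZero n]

open Classical in
/-- generator or zero -/
noncomputable def T (x y : Equiv.Perm (ZMod n)) (D : ZMod n → ZMod n → ℤ) : CDModule n :=
  if h : IsGridPosDomain n x y D then Finsupp.single (⟨(x, y, D), h⟩ : GenCD n) 1 else 0

/-- sign of the grading -/
noncomputable def grSign (grd : MaslovGrading n) (x y : Equiv.Perm (ZMod n)) (D : ZMod n → ZMod n → ℤ) : ℤ :=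
  (((-1 : ℤˣ) ^ grd.gr x y D : ℤˣ) : ℤ)

theorem pos_add_left {x w y : Equiv.Perm (ZMod n)} {R E : ZMod n → ZMod n → ℤ}
    (hR : IsGridPosDomain n x w R) (hE : IsGridPosDomain n w y E) : IsGridPosDomain n x y (R + E) := by
  refine ⟨⟨?_, fun i j => ?_⟩, fun i j => add_nonneg (hR.2 i j) (hE.2 i j)⟩
  · simp only [Pi.add_apply, hR.1.1, hE.1.1]; rfl
  · have h1 := hR.1.2 i j
    have h2 := hE.1.2 i j
    simp only [Pi.add_apply]
    linarith

theorem left_term (s : ℤ) (w y : Equiv.Perm (ZMod n)) (R D : ZMod n → ZMod n → ℤ) (P : Prop) [Decidable P] :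
    (∑ᶠ (E : ZMod n → ZMod n → ℤ) (_ : P) (hE : IsGridPosDomain n w y E) (_ : R + E = D),
        s • Finsupp.single (⟨(w, y, E), hE⟩ : GenCD n) (1 : ℤ)) =
      if P then s • T w y (D - R) else 0 := by
  classical
  rw [finsum_eq_single _ (D - R)]
  · by_cases hP : P
    · simp only [hP, if_true]
      unfold T
      by_cases hE : IsGridPosDomain n w y (D - R)
      · simp [hE]
      · simp [hE]
    · simp [hP]
  · intro E hE
    have : ¬ (R + E = D) := fun h => hE (by rw [← h]; simp)
    simp [this]

theorem right_term (s : (ZMod n → ZMod n → ℤ) → ℤ) (x w y : Equiv.Perm (ZMod n)) (D E : ZMod n → ZMod n → ℤ) :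
    (∑ᶠ (R : ZMod n → ZMod n → ℤ) (hE : IsGridPosDomain n x w E) (_ : IsGridRect n w y R)
      (_ : E + R = D), s R • Finsupp.single (⟨(x, w, E), hE⟩ : GenCD n) (1 : ℤ)) =
      open Classical in
      if IsGridRect n w y (D - E) then s (D - E) • T x w E else 0 := by
  classical
  rw [finsum_eq_single _ (D - E)]
  · unfold T
    by_cases hE : IsGridPosDomain n x w E
    · by_cases hP : IsGridRect n w y (D - E)
      · simp [hE, hP]
      · simp [hE, hP]
    · simp [hE]
  · intro R hR
    have : ¬ (E + R = D) := fun h => hR (by rw [← h]; simp)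
    simp [this]

theorem sum_rects {M : Type*} [AddCommMonoid M] (x w : Equiv.Perm (ZMod n))
    (f : (ZMod n → ZMod n → ℤ) → M) (g : (ZMod n → ZMod n → ℤ) → M)
    (h1 : ∀ R, IsGridRect n x w R → g R = f R) (h2 : ∀ R, ¬ IsGridRect n x w R → g R = 0) :
    ∑ᶠ R, g R = ∑ R ∈ rects x w, f R := by
  rw [finsum_eq_sum_of_support_subset (s := rects x w)]
  · exact Finset.sum_congr rfl fun R hR => h1 R (mem_rects.1 hR)
  · intro R hR
    simp only [Finset.mem_coe, mem_rects]
    by_contra h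
    exact hR (h2 R h)

theorem delta_T (sgn : SignAssignment n) (grd : MaslovGrading n) (x y : Equiv.Perm (ZMod n))
    (D : ZMod n → ZMod n → ℤ) : deltaCD n sgn grd (T x y D) =
      (∑ w, ∑ R ∈ rects x w, sgn.s x w R • T w y (D - R)) +
      grSign grd x y D • ∑ w, ∑ R ∈ rects w y, sgn.s w y R • T x w (D - R) := by
  classical
  by_cases hD : IsGridPosDomain n x y D
  · have : T x y D = Finsupp.single (⟨(x, y, D), hD⟩ : GenCD n) 1 := by
      unfold T; rw [dif_pos hD]
    rw [this]
    unfold deltaCD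
    rw [Finsupp.lift_apply, Finsupp.sum_single_index (by simp), one_smul]
    congr 1
    · rw [finsum_eq_sum_of_fintype]
      refine Finset.sum_congr rfl fun w _ => ?_
      apply sum_rects
      · intro R hR
        rw [left_term, if_pos hR]
      · intro R hR
        rw [left_term, if_neg hR]
    · unfold grSign
      congr 1
      rw [finsum_eq_sum_of_fintype]
      refine Finset.sum_congr rfl fun w _ => ?_
      rw [← finsum_comp_equiv (Equiv.subLeft D)]
      apply sum_rects
      · intro R hR
        simp only [right_term, Equiv.subLeft_apply, sub_sub_cancel]
        rw [if_pos hR]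
      · intro R hR
        simp only [right_term, Equiv.subLeft_apply, sub_sub_cancel]
        rw [if_neg hR]
  · have : T x y D = 0 := by unfold T; rw [dif_neg hD]
    rw [this, map_zero]
    have h1 : ∀ w, ∀ R ∈ rects x w, sgn.s x w R • T w y (D - R) = 0 := by
      intro w R hR
      have hR := (mem_rects.1 hR).1
      unfold T
      rw [dif_neg, smul_zero]
      intro h
      apply hD
      have := pos_add_left hR h
      rwa [add_sub_cancel] at this
    have h2 : ∀ w, ∀ R ∈ rects w y, sgn.s w y R • T x w (D - R) = 0 := by
      intro w R hR
      have hR := (mem_rects.1 hR).1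
      unfold T
      rw [dif_neg, smul_zero]
      intro h
      apply hD
      have := pos_add_left h hR
      rwa [sub_add_cancel] at this
    rw [Finset.sum_eq_zero fun w _ => Finset.sum_eq_zero (h1 w),
      Finset.sum_eq_zero fun w _ => Finset.sum_eq_zero (h2 w), smul_zero, add_zero]

end GridCD
end

section
namespace GridCD
set_option linter.unusedSectionVars false
variable {n : ℕ} [NeZero n]

open Classical in
/-- sums of two rectangle functions -/
noncomputable def sumsF (n : ℕ) [NeZero n] : Finset (ZMod n → ZMod n → ℤ) :=
  (rectsF n ×ˢ rectsF n).image fun t => t.1 + t.2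

theorem regroup {M : Type*} [AddCommGroup M] (sgn : SignAssignment n) (x z : Equiv.Perm (ZMod n))
    (g : (ZMod n → ZMod n → ℤ) → M) :
    ∑ w, ∑ R ∈ rects x w, ∑ S ∈ rects w z, (sgn.s x w R * sgn.s w z S) • g (R + S) =
      if x = z then ∑ F ∈ sumsF n, annC F • g F else 0 := by
  classical
  have h1 : ∑ w, ∑ R ∈ rects x w, ∑ S ∈ rects w z, (sgn.s x w R * sgn.s w z S) • g (R + S) =
      ∑ t ∈ (Finset.univ ×ˢ rectsF n ×ˢ rectsF n).filter
        (fun t : Equiv.Perm (ZMod n) × (ZMod n → ZMod n → ℤ) × (ZMod n → ZMod n → ℤ) =>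
          IsGridRect n x t.1 t.2.1 ∧ IsGridRect n t.1 z t.2.2),
        (sgn.s x t.1 t.2.1 * sgn.s t.1 z t.2.2) • g (t.2.1 + t.2.2) := by
    rw [Finset.sum_filter, Finset.sum_product]
    refine Finset.sum_congr rfl fun w _ => ?_
    rw [Finset.sum_product, rects, Finset.sum_filter]
    refine Finset.sum_congr rfl fun R _ => ?_
    by_cases hR : IsGridRect n x w R
    · simp only [hR, if_true, true_and]
      rw [rects, Finset.sum_filter]
    · simp [hR]
  have h2 := Finset.sum_fiberwise_of_maps_to (s := (Finset.univ ×ˢ rectsF n ×ˢ rectsF n).filter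
        (fun t : Equiv.Perm (ZMod n) × (ZMod n → ZMod n → ℤ) × (ZMod n → ZMod n → ℤ) =>
          IsGridRect n x t.1 t.2.1 ∧ IsGridRect n t.1 z t.2.2)) (t := sumsF n)
        (g := fun t => t.2.1 + t.2.2)
        (fun t ht => by
          simp only [Finset.mem_filter, Finset.mem_product] at ht
          exact Finset.mem_image.2 ⟨(t.2.1, t.2.2), by simp [ht.1.2.1, ht.1.2.2], rfl⟩)
        (fun t => (sgn.s x t.1 t.2.1 * sgn.s t.1 z t.2.2) • g (t.2.1 + t.2.2))
  rw [h1, ← h2]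
  have h3 : ∀ F ∈ sumsF n, ∑ t ∈ ((Finset.univ ×ˢ rectsF n ×ˢ rectsF n).filter
        (fun t : Equiv.Perm (ZMod n) × (ZMod n → ZMod n → ℤ) × (ZMod n → ZMod n → ℤ) =>
          IsGridRect n x t.1 t.2.1 ∧ IsGridRect n t.1 z t.2.2)) with t.2.1 + t.2.2 = F,
        (sgn.s x t.1 t.2.1 * sgn.s t.1 z t.2.2) • g (t.2.1 + t.2.2) =
      (if x = z then annC F else 0) • g F := by
    intro F _
    rw [← csum sgn x z F, Finset.sum_smul]
    refine Finset.sum_congr ?_ ?_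
    · ext t
      rw [mem_decs]
      simp only [Finset.mem_filter, Finset.mem_product, Finset.mem_univ, true_and]
      constructor
      · rintro ⟨⟨_, h1, h2⟩, h3⟩; exact ⟨h1, h2, h3⟩
      · rintro ⟨h1, h2, h3⟩; exact ⟨⟨⟨rect_mem h1, rect_mem h2⟩, h1, h2⟩, h3⟩
    · intro t ht
      rw [mem_decs] at ht
      rw [ht.2.2]
  rw [Finset.sum_congr rfl h3]
  by_cases hxz : x = z
  · simp [hxz]
  · simp [hxz]

theorem T_ne {x y : Equiv.Perm (ZMod n)} {D : ZMod n → ZMod n → ℤ} (h : ¬ IsGridPosDomain n x y D) :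
    T x y D = 0 := by unfold T; rw [dif_neg h]

theorem grSign_left (grd : MaslovGrading n) {x w y : Equiv.Perm (ZMod n)} {R D : ZMod n → ZMod n → ℤ}
    (hR : IsGridRect n x w R) (hE : IsGridPosDomain n w y (D - R)) :
    grSign grd x y D = - grSign grd w y (D - R) := by
  have := grd.gr_left x w y R (D - R) hR hE
  rw [add_sub_cancel] at this
  unfold grSign
  rw [this, zpow_add, zpow_one]; simp

theorem grSign_right (grd : MaslovGrading n) {x w y : Equiv.Perm (ZMod n)} {R D : ZMod n → ZMod n → ℤ}
    (hE : IsGridPosDomain n x w (D - R)) (hR : IsGridRect n w y R) :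
    grSign grd x y D = - grSign grd x w (D - R) := by
  have := grd.gr_right x w y (D - R) R hE hR
  rw [sub_add_cancel] at this
  unfold grSign
  rw [this, zpow_add, zpow_one]; simp

theorem grSign_sq (grd : MaslovGrading n) (x y : Equiv.Perm (ZMod n)) (D : ZMod n → ZMod n → ℤ) :
    grSign grd x y D * grSign grd x y D = 1 := by
  unfold grSign
  rw [← Units.val_mul, ← mul_zpow]; simp

theorem delta_sq_T (sgn : SignAssignment n) (grd : MaslovGrading n) (x y : Equiv.Perm (ZMod n))
    (D : ZMod n → ZMod n → ℤ) : deltaCD n sgn grd (deltaCD n sgn grd (T x y D)) = 0 := by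
  classical
  have LL : ∑ w, ∑ R ∈ rects x w, sgn.s x w R • ∑ w', ∑ S ∈ rects w w', sgn.s w w' S • T w' y (D - R - S)
      = ∑ F ∈ sumsF n, annC F • T x y (D - F) := by
    have h1 : ∀ z, ∑ w, ∑ R ∈ rects x w, ∑ S ∈ rects w z, (sgn.s x w R * sgn.s w z S) • T z y (D - (R + S)) = if x = z then ∑ F ∈ sumsF n, annC F • T z y (D - F) else 0 :=
      fun z => regroup sgn x z (fun F => T z y (D - F))
    have h2 : ∑ z, (if x = z then ∑ F ∈ sumsF n, annC F • T z y (D - F) else 0) = 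
      ∑ F ∈ sumsF n, annC F • T x y (D - F) := by simp
    rw [← h2, ← Finset.sum_congr rfl fun z _ => h1 z, Finset.sum_comm]
    refine Finset.sum_congr rfl fun w _ => ?_
    rw [Finset.sum_comm]
    refine Finset.sum_congr rfl fun R _ => ?_
    simp only [Finset.smul_sum, smul_smul, sub_sub]
  have RR : grSign grd x y D • ∑ w, ∑ S ∈ rects w y, sgn.s w y S • (grSign grd x w (D - S) •
      ∑ w', ∑ R ∈ rects w' w, sgn.s w' w R • T x w' (D - S - R))
      = - ∑ F ∈ sumsF n, annC F • T x y (D - F) := by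
    have h1 : ∀ z, ∑ w, ∑ R ∈ rects z w, ∑ S ∈ rects w y, (sgn.s z w R * sgn.s w y S) • T x z (D - (R + S)) = if z = y then ∑ F ∈ sumsF n, annC F • T x z (D - F) else 0 :=
      fun z => regroup sgn z y (fun F => T x z (D - F))
    have h2 : ∑ z, (if z = y then ∑ F ∈ sumsF n, annC F • T x z (D - F) else 0) = 
      ∑ F ∈ sumsF n, annC F • T x y (D - F) := by simp
    rw [← h2, ← Finset.sum_congr rfl fun z _ => h1 z, Finset.sum_comm, Finset.smul_sum,
      ← Finset.sum_neg_distrib]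
    refine Finset.sum_congr rfl fun w _ => ?_
    simp only [Finset.smul_sum, smul_smul]
    rw [Finset.sum_comm, ← Finset.sum_neg_distrib]
    refine Finset.sum_congr rfl fun z _ => ?_
    rw [Finset.sum_comm, ← Finset.sum_neg_distrib]
    refine Finset.sum_congr rfl fun R hR => ?_
    rw [← Finset.sum_neg_distrib]
    refine Finset.sum_congr rfl fun S hS => ?_
    rw [mem_rects] at hR hS
    rw [show D - (R + S) = D - S - R by rw [sub_sub, add_comm]]
    by_cases hE : IsGridPosDomain n x z (D - S - R)
    · have hE' : IsGridPosDomain n x w (D - S) := by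
        have := pos_add_left hE hR.1
        rwa [sub_add_cancel] at this
      rw [grSign_right grd hE' hS, ← neg_smul]
      congr 1
      have := grSign_sq grd x w (D - S)
      linear_combination (-sgn.s w y S * sgn.s z w R) * this
    · rw [T_ne hE]; simp
  have MM : ∑ w, ∑ R ∈ rects x w, sgn.s x w R • (grSign grd w y (D - R) •
      ∑ w', ∑ S ∈ rects w' y, sgn.s w' y S • T w w' (D - R - S)) +
      grSign grd x y D • ∑ w', ∑ S ∈ rects w' y, sgn.s w' y S • 
        ∑ w, ∑ R ∈ rects x w, sgn.s x w R • T w w' (D - S - R) = 0 := by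
    simp only [Finset.smul_sum, smul_smul]
    rw [← eq_neg_iff_add_eq_zero, ← Finset.sum_neg_distrib]
    have e : ∀ w : Equiv.Perm (ZMod n), ∑ R ∈ rects x w, ∑ w', ∑ S ∈ rects w' y,
        (sgn.s x w R * (grSign grd w y (D - R) * sgn.s w' y S)) • T w w' (D - R - S) =
        ∑ w', ∑ S ∈ rects w' y, ∑ R ∈ rects x w, 
        (sgn.s x w R * (grSign grd w y (D - R) * sgn.s w' y S)) • T w w' (D - R - S) := by
      intro w
      rw [Finset.sum_comm]
      exact Finset.sum_congr rfl fun _ _ => Finset.sum_comm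
    rw [Finset.sum_congr rfl fun w _ => e w, Finset.sum_comm]
    refine Finset.sum_congr rfl fun w' _ => ?_
    rw [Finset.sum_comm, ← Finset.sum_neg_distrib]
    refine Finset.sum_congr rfl fun S hS => ?_
    rw [← Finset.sum_neg_distrib]
    refine Finset.sum_congr rfl fun w _ => ?_
    rw [← Finset.sum_neg_distrib]
    refine Finset.sum_congr rfl fun R hR => ?_
    rw [mem_rects] at hR hS
    rw [sub_right_comm D S R]
    by_cases hE : IsGridPosDomain n w w' (D - R - S)
    · have hE' : IsGridPosDomain n w y (D - R) := by
        have := pos_add_left hE hS.1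
        rwa [sub_add_cancel] at this
      rw [grSign_left grd hR hE', ← neg_smul]
      congr 1
      ring
    · rw [T_ne hE]; simp
  rw [delta_T]
  simp only [map_add, map_smul, map_sum]
  simp only [delta_T, smul_add, Finset.sum_add_distrib]
  rw [LL, RR]
  rw [add_assoc, ← add_assoc _ _ (-_), MM]
  simp

theorem T_gen (g : GenCD n) : T g.1.1 g.1.2.1 g.1.2.2 = Finsupp.single g 1 := by
  unfold T; rw [dif_pos g.2]

theorem delta_sq (sgn : SignAssignment n) (grd : MaslovGrading n) (v : CDModule n) :
    deltaCD n sgn grd (deltaCD n sgn grd v) = 0 := by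
  have : (deltaCD n sgn grd) ∘ₗ (deltaCD n sgn grd) = 0 := by
    apply Finsupp.lhom_ext'
    intro g
    apply LinearMap.ext_ring
    simp only [LinearMap.comp_apply, Finsupp.lsingle_apply, LinearMap.zero_apply]
    rw [← T_gen, delta_sq_T]
  exact LinearMap.congr_fun this v

end GridCD
end

section
namespace GridCD

theorem morse {G α : Type*} [LinearOrder α] [WellFoundedLT α] (d : (G →₀ ℤ) →ₗ[ℤ] (G →₀ ℤ))
    (hd : ∀ v, d (d v) = 0) (c : G) (hc : d (Finsupp.single c 1) = 0) (ρ : G → α)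
    (isP : G → Prop) (τ : G → G)
    (hunit : ∀ p, isP p → d (Finsupp.single p 1) (τ p) = 1 ∨ d (Finsupp.single p 1) (τ p) = -1)
    (hτP : ∀ p, isP p → ¬ isP (τ p))
    (hτc : ∀ p, isP p → τ p ≠ c)
    (hρ : ∀ p, isP p → ρ (τ p) = ρ p)
    (hinj : ∀ p p', isP p → isP p' → τ p = τ p' → p = p')
    (hsurj : ∀ q, ¬ isP q → q ≠ c → ∃ p, isP p ∧ τ p = q)
    (hdrop : ∀ p q, isP p → ¬ isP q → q ≠ c → q ≠ τ p → d (Finsupp.single p 1) q ≠ 0 → ρ q < ρ p)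
    (hPc : ¬ isP c)
    (v : G →₀ ℤ) (hv : d v = 0) : ∃ (m : ℤ) (w : G →₀ ℤ), v = m • Finsupp.single c 1 + d w := by
  classical
  set W : Submodule ℤ (G →₀ ℤ) := Finsupp.supported ℤ ℤ {g | isP g ∨ g = c} with hW
  have hWm : ∀ g, isP g ∨ g = c → Finsupp.single g (1 : ℤ) ∈ W := fun g hg =>
    Finsupp.single_mem_supported ℤ 1 hg
  have step1 : ∀ a : α, ∀ q, ρ q = a → Finsupp.single q (1 : ℤ) ∈ LinearMap.range d ⊔ W := by
    intro a
    induction a using WellFoundedLT.induction with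
    | ind a ih =>
    intro q hq
    by_cases h : isP q ∨ q = c
    · exact Submodule.mem_sup_right (hWm q h)
    push Not at h
    obtain ⟨p, hp, hpq⟩ := hsurj q h.1 h.2
    have e : d (Finsupp.single p 1) = Finsupp.single q (d (Finsupp.single p 1) q) +
        (d (Finsupp.single p 1)).erase q := (Finsupp.single_add_erase _ _).symm
    have hr : (d (Finsupp.single p 1)).erase q ∈ LinearMap.range d ⊔ W := by
      rw [← Finsupp.sum_single ((d (Finsupp.single p 1)).erase q)]
      apply Submodule.sum_mem
      intro g hg
      have hgq : g ≠ q := by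
        rintro rfl
        simp at hg
      have hg0 : d (Finsupp.single p 1) g ≠ 0 := by
        rw [Finsupp.mem_support_iff, Finsupp.erase_ne hgq] at hg
        exact hg
      have : Finsupp.single g (1 : ℤ) ∈ LinearMap.range d ⊔ W := by
        by_cases h' : isP g ∨ g = c
        · exact Submodule.mem_sup_right (hWm g h')
        push Not at h'
        have hlt := hdrop p g hp h'.1 h'.2 (by rw [hpq]; exact hgq) hg0
        rw [← hρ p hp, hpq, hq] at hlt
        exact ih _ hlt g rfl
      have := Submodule.smul_mem _ (((d (Finsupp.single p 1)).erase q) g) this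
      simpa using this
    have h1 : Finsupp.single q (d (Finsupp.single p 1) q) ∈ LinearMap.range d ⊔ W := by
      have h2 : d (Finsupp.single p 1) ∈ LinearMap.range d ⊔ W :=
        Submodule.mem_sup_left (LinearMap.mem_range_self _ _)
      have := Submodule.sub_mem _ h2 hr
      rw [e] at this
      simpa using this
    have hu := hunit p hp
    rw [hpq] at hu
    rcases hu with hu | hu
    · rwa [hu] at h1
    · rw [hu] at h1
      have := Submodule.neg_mem _ h1
      rwa [← Finsupp.single_neg, neg_neg] at this
  have hall : v ∈ LinearMap.range d ⊔ W := by
    rw [← Finsupp.sum_single v]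
    apply Submodule.sum_mem
    intro g _
    have := Submodule.smul_mem _ (v g) (step1 _ g rfl)
    simpa using this
  obtain ⟨u, ⟨w, rfl⟩, v', hv', rfl⟩ := Submodule.mem_sup.1 hall
  have hdv' : d v' = 0 := by
    rw [map_add, hd, zero_add] at hv
    exact hv
  have hsupp : ∀ g ∈ v'.support, isP g ∨ g = c := fun g hg => hv' hg
  by_cases hex : ∃ g ∈ v'.support, isP g
  · exfalso
    obtain ⟨p, hp, hmax⟩ := Finset.exists_max_image (v'.support.filter isP) ρ
      (by obtain ⟨g, h1, h2⟩ := hex; exact ⟨g, by simp only [Finset.mem_filter]; exact ⟨h1, h2⟩⟩)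
    rw [Finset.mem_filter] at hp
    have h0 : d v' (τ p) = 0 := by rw [hdv']; rfl
    have e : d v' = ∑ g ∈ v'.support, v' g • d (Finsupp.single g 1) := by
      conv_lhs => rw [← Finsupp.sum_single v']
      rw [Finsupp.sum, map_sum]
      refine Finset.sum_congr rfl fun g _ => ?_
      rw [← map_smul]; simp
    rw [e, Finsupp.finsetSum_apply, Finset.sum_eq_single p] at h0
    · have hvp : v' p ≠ 0 := Finsupp.mem_support_iff.1 hp.1
      rw [Finsupp.smul_apply] at h0
      rcases hunit p hp.2 with h | h
      · rw [h] at h0; simp at h0; exact hvp h0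
      · rw [h] at h0; simp at h0; exact hvp h0
    · intro p' hp' hne
      rw [Finsupp.smul_apply]
      rcases hsupp p' hp' with h | h
      · by_contra hcon
        have hnz : d (Finsupp.single p' 1) (τ p) ≠ 0 := by
          intro h; rw [h] at hcon; simp at hcon
        have hlt := hdrop p' (τ p) h (hτP p hp.2) (hτc p hp.2)
          (fun h' => hne (hinj p p' hp.2 h h').symm) hnz
        rw [hρ p hp.2] at hlt
        have := hmax p' (by rw [Finset.mem_filter]; exact ⟨hp', h⟩)
        exact absurd hlt (not_lt.2 this)
      · rw [h, hc]; simp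
    · intro h; exact absurd hp.1 h
  · push Not at hex
    refine ⟨v' c, w, ?_⟩
    rw [add_comm]
    congr 1
    ext g
    by_cases hg : g = c
    · subst hg; simp
    · have : v' g = 0 := by
        by_contra h
        have hm := Finsupp.mem_support_iff.2 h
        exact (hsupp g hm).elim (hex g hm) hg
      simp [this, Finsupp.single_apply, Ne.symm hg]

end GridCD
end

section
namespace GridCD
set_option linter.unusedSectionVars false
variable {n : ℕ} [NeZero n]

theorem rect_ne_zero {x y : Equiv.Perm (ZMod n)} {R : ZMod n → ZMod n → ℤ} (h : IsGridRect n x y R) :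
    ∃ i j, R i j = 1 := by
  rw [rect_iff] at h
  obtain ⟨a, b, hab, -, rfl, -, -⟩ := h
  exact ⟨a, x a, by rw [rectFn, ind_self _ _ hab, ind_self _ _ (fun e => hab (x.injective e))]; rfl⟩

theorem pos_zero {x y : Equiv.Perm (ZMod n)} (h : IsGridPosDomain n x y 0) : x = y :=
  dom_eq h.1.2 (fun i j => by simp)

theorem delta_c (sgn : SignAssignment n) (grd : MaslovGrading n) (x : Equiv.Perm (ZMod n)) :
    deltaCD n sgn grd (T x x 0) = 0 := by
  have key : ∀ u v u' v' R, IsGridRect n u v R → T u' v' (0 - R) = 0 := by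
    intro u v u' v' R hR
    apply T_ne
    intro h
    obtain ⟨i, j, hij⟩ := rect_ne_zero hR
    have := h.2 i j
    simp [hij] at this
  rw [delta_T]
  have h1 : ∑ w, ∑ R ∈ rects x w, sgn.s x w R • T w x (0 - R) = 0 :=
    Finset.sum_eq_zero fun w _ => Finset.sum_eq_zero fun R hR => by
      rw [key _ _ _ _ _ (mem_rects.1 hR), smul_zero]
  have h2 : ∑ w, ∑ R ∈ rects w x, sgn.s w x R • T x w (0 - R) = 0 :=
    Finset.sum_eq_zero fun w _ => Finset.sum_eq_zero fun R hR => by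
      rw [key _ _ _ _ _ (mem_rects.1 hR), smul_zero]
  rw [h1, h2]; simp

open Classical in
/-- augmentation -/
noncomputable def eps (n : ℕ) : CDModule n →ₗ[ℤ] ℤ :=
  Finsupp.lift ℤ ℤ (GenCD n) fun g => if g.1.2.2 = 0 then 1 else 0

theorem eps_T (x y : Equiv.Perm (ZMod n)) (D : ZMod n → ZMod n → ℤ) :
    eps n (T x y D) = open Classical in if x = y ∧ D = 0 then 1 else 0 := by
  classical
  by_cases h : IsGridPosDomain n x y D
  · unfold T eps
    rw [dif_pos h, Finsupp.lift_apply, Finsupp.sum_single_index (by simp)]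
    by_cases hD : D = 0
    · subst hD
      simp [pos_zero h]
    · simp [hD]
  · rw [T_ne h, map_zero, if_neg]
    rintro ⟨rfl, rfl⟩
    exact h (isGridPosDomain_zero n x)

theorem eps_delta_T (sgn : SignAssignment n) (grd : MaslovGrading n) (x y : Equiv.Perm (ZMod n))
    (D : ZMod n → ZMod n → ℤ) : eps n (deltaCD n sgn grd (T x y D)) = 0 := by
  classical
  rw [delta_T]
  simp only [map_add, map_smul, map_sum, eps_T]
  have h1 : ∑ w, ∑ R ∈ rects x w, sgn.s x w R • (if w = y ∧ D - R = 0 then (1 : ℤ) else 0) =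
      if IsGridRect n x y D then sgn.s x y D else 0 := by
    rw [Finset.sum_eq_single y]
    · simp only [true_and, sub_eq_zero, smul_eq_mul, mul_ite, mul_one, mul_zero]
      rw [Finset.sum_ite_eq]
      simp only [mem_rects]
    · intro w _ hw
      apply Finset.sum_eq_zero
      intro R _
      simp [hw]
    · simp
  have h2 : ∑ w, ∑ R ∈ rects w y, sgn.s w y R • (if x = w ∧ D - R = 0 then (1 : ℤ) else 0) =
      if IsGridRect n x y D then sgn.s x y D else 0 := by
    rw [Finset.sum_eq_single x]
    · simp only [true_and, sub_eq_zero, smul_eq_mul, mul_ite, mul_one, mul_zero]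
      rw [Finset.sum_ite_eq]
      simp only [mem_rects]
    · intro w _ hw
      apply Finset.sum_eq_zero
      intro R _
      simp [Ne.symm hw]
    · simp
  rw [h1, h2]
  by_cases h : IsGridRect n x y D
  · have : grSign grd x y D = -1 := by
      have := grd.gr_left x y y D 0 h (isGridPosDomain_zero n y)
      rw [grd.gr_zero, add_zero] at this
      unfold grSign
      rw [this]; simp
    rw [if_pos h, this]; simp
  · simp [h]

theorem eps_delta (sgn : SignAssignment n) (grd : MaslovGrading n) (v : CDModule n) :
    eps n (deltaCD n sgn grd v) = 0 := by
  have : (eps n) ∘ₗ (deltaCD n sgn grd) = 0 := by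
    apply Finsupp.lhom_ext'
    intro g
    apply LinearMap.ext_ring
    simp only [LinearMap.comp_apply, Finsupp.lsingle_apply, LinearMap.zero_apply]
    rw [← T_gen, eps_delta_T]
  exact LinearMap.congr_fun this v

theorem T_apply (x y : Equiv.Perm (ZMod n)) (D : ZMod n → ZMod n → ℤ) (q : GenCD n) :
    (T x y D) q = open Classical in if (x, y, D) = q.1 then 1 else 0 := by
  classical
  by_cases h : IsGridPosDomain n x y D
  · unfold T
    rw [dif_pos h, Finsupp.single_apply]
    simp only [Subtype.ext_iff]
  · rw [T_ne h, if_neg]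
    · rfl
    · intro e
      have := q.2
      rw [← e] at this
      exact h this

theorem delta_coef (sgn : SignAssignment n) (grd : MaslovGrading n) (x y : Equiv.Perm (ZMod n))
    (D : ZMod n → ZMod n → ℤ) (q : GenCD n) (h : deltaCD n sgn grd (T x y D) q ≠ 0) :
    (∃ w R, IsGridRect n x w R ∧ q.1 = (w, y, D - R)) ∨
    (∃ w R, IsGridRect n w y R ∧ q.1 = (x, w, D - R)) := by
  classical
  by_contra hcon
  push Not at hcon
  apply h
  rw [delta_T, Finsupp.add_apply, Finsupp.smul_apply, Finsupp.finsetSum_apply,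
    Finsupp.finsetSum_apply]
  have h1 : ∀ w : Equiv.Perm (ZMod n), (∑ R ∈ rects x w, sgn.s x w R • T w y (D - R)) q = 0 := by
    intro w
    rw [Finsupp.finsetSum_apply]
    apply Finset.sum_eq_zero
    intro R hR
    rw [Finsupp.smul_apply, T_apply, if_neg (fun e => hcon.1 w R (mem_rects.1 hR) e.symm), smul_zero]
  have h2 : ∀ w : Equiv.Perm (ZMod n), (∑ R ∈ rects w y, sgn.s w y R • T x w (D - R)) q = 0 := by
    intro w
    rw [Finsupp.finsetSum_apply]
    apply Finset.sum_eq_zero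
    intro R hR
    rw [Finsupp.smul_apply, T_apply, if_neg (fun e => hcon.2 w R (mem_rects.1 hR) e.symm), smul_zero]
  simp [h1, h2]

theorem delta_coef_unit (sgn : SignAssignment n) (grd : MaslovGrading n) (x w y : Equiv.Perm (ZMod n))
    (D R : ZMod n → ZMod n → ℤ) (q : GenCD n) (hR : IsGridRect n x w R) (hq : q.1 = (w, y, D - R)) :
    deltaCD n sgn grd (T x y D) q = 1 ∨ deltaCD n sgn grd (T x y D) q = -1 := by
  classical
  have hxw : x ≠ w := by
    intro e
    rw [rect_iff] at hR
    obtain ⟨a, b, hab, hw, -, -, -⟩ := hR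
    rw [← e] at hw
    have := congrArg (fun f : Equiv.Perm (ZMod n) => f a) hw
    simp only [Equiv.Perm.mul_apply, Equiv.swap_apply_left] at this
    exact hab (x.injective this)
  have : deltaCD n sgn grd (T x y D) q = sgn.s x w R := by
    rw [delta_T, Finsupp.add_apply, Finsupp.smul_apply, Finsupp.finsetSum_apply,
      Finsupp.finsetSum_apply]
    have h2 : ∀ w' : Equiv.Perm (ZMod n), (∑ R ∈ rects w' y, sgn.s w' y R • T x w' (D - R)) q = 0 := by
      intro w'
      rw [Finsupp.finsetSum_apply]
      apply Finset.sum_eq_zero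
      intro R' hR'
      rw [Finsupp.smul_apply, T_apply, if_neg, smul_zero]
      rw [hq]
      intro e
      simp only [Prod.mk.injEq] at e
      exact hxw e.1
    rw [Finset.sum_eq_zero (fun w' _ => h2 w'), smul_zero, add_zero, Finset.sum_eq_single w]
    · rw [Finsupp.finsetSum_apply, Finset.sum_eq_single R]
      · rw [Finsupp.smul_apply, T_apply, if_pos hq.symm]; simp
      · intro R' hR' hne
        rw [Finsupp.smul_apply, T_apply, if_neg, smul_zero]
        rw [hq]
        intro e
        simp only [Prod.mk.injEq, sub_right_inj] at e
        exact hne e.2.2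
      · intro h; exact absurd (mem_rects.2 hR) h
    · intro w' _ hne
      rw [Finsupp.finsetSum_apply]
      apply Finset.sum_eq_zero
      intro R' hR'
      rw [Finsupp.smul_apply, T_apply, if_neg, smul_zero]
      rw [hq]
      intro e
      simp only [Prod.mk.injEq] at e
      exact hne e.1
    · simp
  rw [this]
  exact sgn.s_unit x w R hR

end GridCD
end

section
namespace GridCD
set_option linter.unusedSectionVars false
variable {n : ℕ} [NeZero n]

theorem jump {x y : Equiv.Perm (ZMod n)} {D : ZMod n → ZMod n → ℤ} (h : IsGridPosDomain n x y D)
    (i j : ZMod n) : D i j - D (i - 1) j = D i (-1) - D (i - 1) (-1) +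
      (if (x i).val ≤ j.val then 1 else 0) - (if (y i).val ≤ j.val then 1 else 0) := by
  obtain ⟨m, hm⟩ : ∃ m, j.val = m := ⟨_, rfl⟩
  induction m generalizing j with
  | zero =>
    have hj : j = 0 := by rwa [ZMod.val_eq_zero] at hm
    subst hj
    have := h.1.2 i 0
    rw [zero_sub] at this
    simp only [ZMod.val_zero, Nat.le_zero, ZMod.val_eq_zero]
    linarith
  | succ m ih =>
    have h1 : (j - 1).val = m := by rw [val_sub_one, hm]; simp
    have h2 := ih (j - 1) h1
    have h3 := h.1.2 i j
    rw [h1] at h2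
    have e : ∀ u : ZMod n, u = j ↔ u.val = m + 1 := fun u =>
      ⟨fun e => by rw [e, hm], fun e => ZMod.val_injective n (by rw [e, hm])⟩
    simp only [e] at h3
    rw [hm]
    have e2 : ∀ u : ZMod n, ((if u.val ≤ m + 1 then 1 else 0 : ℤ)) =
      (if u.val ≤ m then 1 else 0) + if u.val = m + 1 then 1 else 0 := by
      intro u; split_ifs <;> omega
    rw [e2, e2]
    linarith

theorem pos_tr {x y : Equiv.Perm (ZMod n)} {D : ZMod n → ZMod n → ℤ} (h : IsGridPosDomain n x y D) :
    IsGridPosDomain n x⁻¹ y⁻¹ (tr D) := by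
  refine ⟨⟨h.1.1, fun i j => ?_⟩, fun i j => h.2 j i⟩
  have h1 := h.1.2 j i
  have e : ∀ z : Equiv.Perm (ZMod n), z⁻¹ i = j ↔ z j = i := by
    intro z
    rw [Equiv.Perm.inv_eq_iff_eq, eq_comm]
  simp only [tr, e]
  linarith

/-- matching data -/
structure Move (y : Equiv.Perm (ZMod n)) (A B : ZMod n → ℤ) where
  up : Equiv.Perm (ZMod n) → Prop
  σ : Equiv.Perm (ZMod n) → Equiv.Perm (ZMod n)
  R : Equiv.Perm (ZMod n) → (ZMod n → ZMod n → ℤ)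
  up_σ : ∀ x, up (σ x) ↔ ¬ up x
  σσ : ∀ x, σ (σ x) = x
  rect : ∀ x, up x → IsGridRect n x (σ x) (R x)
  planarA : ∀ x, up x → ∀ j, R x (-1) j = 0
  planarB : ∀ x, up x → ∀ i, R x i (-1) = 0
  le : ∀ x D, IsGridPosDomain n x y D → (∀ j, D (-1) j = A j) → (∀ i, D i (-1) = B i) → up x →
    ∀ i j, R x i j ≤ D i j
  uniq : ∀ x w S, IsGridRect n x w S → (∀ j, S (-1) j = 0) → (∀ i, S i (-1) = 0) → up x → ¬ up w →
    w = σ x ∧ S = R x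

/-- transposed matching data -/
def Move.transpose {y : Equiv.Perm (ZMod n)} {A B : ZMod n → ℤ} (M : Move y A B) : Move y⁻¹ B A where
  up x := M.up x⁻¹
  σ x := (M.σ x⁻¹)⁻¹
  R x := tr (M.R x⁻¹)
  up_σ x := by rw [inv_inv]; exact M.up_σ _
  σσ x := by rw [inv_inv, M.σσ, inv_inv]
  rect x hx := by
    have := rect_tr (M.rect _ hx)
    rwa [inv_inv] at this
  planarA x hx := M.planarB _ hx
  planarB x hx := M.planarA _ hx
  le x D hD hA hB hx i j := by
    have h := pos_tr hD
    rw [inv_inv] at h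
    exact M.le _ _ h hB hA hx j i
  uniq x w S hS h1 h2 hx hw := by
    obtain ⟨e1, e2⟩ := M.uniq _ _ _ (rect_tr hS) h2 h1 hx hw
    exact ⟨by rw [← e1, inv_inv], by rw [← e2]; rfl⟩

theorem ind_last (a b : ZMod n) (h : a ≠ b) : ind a b (-1) = 0 ↔ a.val < b.val := by
  have ha := ZMod.val_lt a
  have hb := ZMod.val_lt b
  unfold ind
  rw [cN_def, val_neg_one']
  by_cases h : a.val < b.val
  · simp [h]; omega
  · simp [h]; omega

theorem ind_btw (a b u : ZMod n) (h : a.val < b.val) :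
    ind a b u = if a.val ≤ u.val ∧ u.val < b.val then 1 else 0 := by
  unfold ind
  rw [cN_def, if_pos h]; simp

/-- planar rectangles -/
theorem planar_iff {x w : Equiv.Perm (ZMod n)} {S : ZMod n → ZMod n → ℤ} (hS : IsGridRect n x w S)
    (h1 : ∀ j, S (-1) j = 0) (h2 : ∀ i, S i (-1) = 0) :
    ∃ a b : ZMod n, a.val < b.val ∧ (x a).val < (x b).val ∧ w = x * Equiv.swap a b ∧
      S = rectFn a b (x a) (x b) ∧ ∀ u, a.val < u.val → u.val < b.val → (x a).val < (x u).val →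
        (x u).val < (x b).val → False := by
  rw [rect_iff] at hS
  obtain ⟨a, b, hab, rfl, rfl, -, hE⟩ := hS
  have hxab : x a ≠ x b := fun e => hab (x.injective e)
  have k1 := h1 (x a)
  have k2 := h2 a
  simp only [rectFn, ind_self _ _ hab, ind_self _ _ hxab, one_mul, mul_one] at k1 k2
  rw [ind_last _ _ hab] at k1
  rw [ind_last _ _ hxab] at k2
  refine ⟨a, b, k1, k2, rfl, rfl, ?_⟩
  intro u p1 p2 p3 p4
  have := hE u (by rintro rfl; omega) (by rintro rfl; omega)
  rw [rectFn, ind_btw _ _ _ k1, ind_btw _ _ _ k2, if_pos ⟨p1.le, p2⟩, if_pos ⟨p3.le, p4⟩] at this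
  norm_num at this

theorem val_succ {k : ZMod n} (hk : k ≠ -1) : (k + 1).val = k.val + 1 ∧ k.val + 1 < n := by
  have h1 := val_ne hk
  rw [val_neg_one'] at h1
  have := ZMod.val_lt k
  rw [val_add_one, if_neg h1]
  exact ⟨rfl, by omega⟩

/-- column moves -/
def colMove (y : Equiv.Perm (ZMod n)) (A B : ZMod n → ℤ) (k : ZMod n) (hk : k ≠ -1)
    (hgood : ∀ x D, IsGridPosDomain n x y D → (∀ j, D (-1) j = A j) → (∀ i, D i (-1) = B i) →
      (x k).val < (x (k + 1)).val → ∀ j : ZMod n, (x k).val ≤ j.val → j.val < (x (k + 1)).val →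
      1 ≤ D k j) : Move y A B where
  up x := (x k).val < (x (k + 1)).val
  σ x := x * Equiv.swap k (k + 1)
  R x := rectFn k (k + 1) (x k) (x (k + 1))
  up_σ x := by
    have : (x k).val ≠ (x (k + 1)).val := val_ne fun e => ne_add_one hk (x.injective e)
    simp only [Equiv.Perm.mul_apply, Equiv.swap_apply_left, Equiv.swap_apply_right]
    omega
  σσ x := by rw [mul_assoc, Equiv.swap_mul_self, mul_one]
  rect x hx := by
    rw [rect_iff]
    refine ⟨k, k + 1, ne_add_one hk, rfl, rfl, ?_, ?_⟩
    · rw [rectFn, ind_succ k _ (ne_add_one hk), if_neg (Ne.symm hk), zero_mul]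
    · intro i h1 _
      rw [rectFn, ind_succ k _ (ne_add_one hk), if_neg h1, zero_mul]
  planarA x _ j := by
    rw [rectFn, ind_succ k _ (ne_add_one hk), if_neg (Ne.symm hk), zero_mul]
  planarB x hx i := by
    have : ind (x k) (x (k + 1)) (-1) = 0 :=
      (ind_last _ _ (fun e => ne_add_one hk (x.injective e))).2 hx
    rw [rectFn, this, mul_zero]
  le x D hD hA hB hx i j := by
    have := hgood x D hD hA hB hx j
    have h0 := hD.2 i j
    rw [rectFn, ind_succ k _ (ne_add_one hk), ind_btw _ _ _ hx]
    by_cases h1 : i = k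
    · subst h1
      by_cases h2 : (x i).val ≤ j.val ∧ j.val < (x (i + 1)).val
      · rw [if_pos rfl, if_pos h2]
        have := this h2.1 h2.2
        linarith
      · rw [if_neg h2, mul_zero]; exact h0
    · rw [if_neg h1, zero_mul]; exact h0
  uniq x w S hS h1 h2 hx hw := by
    obtain ⟨a, b, hab, hxab, rfl, rfl, hE⟩ := planar_iff hS h1 h2
    have hk1 := val_succ hk
    have hne := ne_add_one hk
    have inj : ∀ u v : ZMod n, u.val = v.val → u = v := fun u v e => ZMod.val_injective n e
    have ab : a ≠ b := by rintro rfl; omega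
    simp only [Equiv.Perm.mul_apply] at hw
    have main : a = k ∧ b = k + 1 := by
      by_cases e1 : a = k
      · subst e1
        refine ⟨rfl, ?_⟩
        by_contra hb
        have hb' := val_ne hb
        rw [Equiv.swap_apply_left, Equiv.swap_apply_of_ne_of_ne (Ne.symm hne) (Ne.symm hb)] at hw
        have : (x b).val ≠ (x (a + 1)).val := val_ne fun e => hb (x.injective e)
        exact hE (a + 1) (by omega) (by omega) (by omega) (by omega)
      · exfalso
        by_cases e2 : b = k + 1
        · subst e2
          have ha' := val_ne e1
          rw [Equiv.swap_apply_right, Equiv.swap_apply_of_ne_of_ne (Ne.symm e1) hne] at hw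
          have : (x a).val ≠ (x k).val := val_ne fun e => e1 (x.injective e)
          exact hE k (by omega) (by omega) (by omega) (by omega)
        · by_cases e3 : a = k + 1
          · have e4 : b ≠ k := by rintro rfl; rw [e3] at hab; omega
            rw [e3, Equiv.swap_apply_left,
              Equiv.swap_apply_of_ne_of_ne hne (Ne.symm e4)] at hw
            rw [e3] at hxab
            omega
          · by_cases e4 : b = k
            · rw [e4, Equiv.swap_apply_right,
                Equiv.swap_apply_of_ne_of_ne (Ne.symm e3) (Ne.symm hne)] at hw
              rw [e4] at hxab
              omega
            · rw [Equiv.swap_apply_of_ne_of_ne (Ne.symm e1) (Ne.symm e4),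
                Equiv.swap_apply_of_ne_of_ne (Ne.symm e3) (Ne.symm e2)] at hw
              exact hw hx
    obtain ⟨rfl, rfl⟩ := main
    exact ⟨rfl, rfl⟩

theorem move_B (y : Equiv.Perm (ZMod n)) (A B : ZMod n → ℤ) (hB0 : ∀ i, 0 ≤ B i) (hB1 : B (-1) = 0)
    (hB : ∃ i, B i ≠ 0) : Nonempty (Move y A B) := by
  classical
  obtain ⟨k, hk, hmin⟩ := Finset.exists_min_image (Finset.univ.filter fun i => B i ≠ 0) ZMod.val
    (by obtain ⟨i, hi⟩ := hB; exact ⟨i, by simp [hi]⟩)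
  simp only [Finset.mem_filter, Finset.mem_univ, true_and] at hk hmin
  have hk1 : k ≠ -1 := by rintro rfl; exact hk hB1
  have hprev : B (k - 1) = 0 := by
    by_contra hne
    have := hmin _ hne
    rw [val_sub_one] at this
    by_cases h0 : k.val = 0
    · have : k = 0 := by rwa [ZMod.val_eq_zero] at h0
      rw [this, zero_sub] at hne
      exact hne hB1
    · rw [if_neg h0] at this; omega
  refine ⟨colMove y A B k hk1 ?_⟩
  intro x D hD hA hBD hx j h1 h2
  have hj := jump hD k j
  rw [hBD, hBD, hprev, if_pos h1] at hj
  have := hD.2 (k - 1) j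
  have hBk : 1 ≤ B k := by
    have := hB0 k
    omega
  split_ifs at hj <;> omega

theorem move_y (y : Equiv.Perm (ZMod n)) (A B : ZMod n → ℤ) (hB : ∀ i, B i = 0) (k : ZMod n)
    (hk : k ≠ -1) (hy : (y (k + 1)).val < (y k).val) : Nonempty (Move y A B) := by
  refine ⟨colMove y A B k hk ?_⟩
  intro x D hD hA hBD hx j h1 h2
  have hj := jump hD k j
  have hj' := jump hD (k + 1) j
  rw [add_sub_cancel_right] at hj'
  rw [hBD, hBD, hB, hB, if_pos h1] at hj
  rw [hBD, hBD, hB, hB, if_neg (by omega)] at hj'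
  have := hD.2 (k - 1) j
  have := hD.2 (k + 1) j
  split_ifs at hj hj' <;> omega

theorem exists_descent (y : Equiv.Perm (ZMod n)) (hy : y ≠ 1) :
    ∃ k : ZMod n, k ≠ -1 ∧ (y (k + 1)).val < (y k).val := by
  by_contra hcon
  push Not at hcon
  apply hy
  have step : ∀ k : ZMod n, k ≠ -1 → (y k).val < (y (k + 1)).val := by
    intro k hk
    have h1 := hcon k hk
    have : (y k).val ≠ (y (k + 1)).val := val_ne fun e => ne_add_one hk (y.injective e)
    omega
  have lower : ∀ m : ℕ, ∀ k : ZMod n, k.val = m → m ≤ (y k).val := by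
    intro m
    induction m with
    | zero => intro k _; exact Nat.zero_le _
    | succ m ih =>
      intro k hk
      have h1 : (k - 1).val = m := by rw [val_sub_one, hk]; simp
      have h2 := ih _ h1
      have hkn := ZMod.val_lt k
      have h3 : k - 1 ≠ -1 := by
        intro e
        have := congrArg ZMod.val e
        rw [val_neg_one'] at this
        omega
      have h4 := step _ h3
      rw [sub_add_cancel] at h4
      omega
  have hsum : ∑ k, ((y k).val : ℕ) = ∑ k : ZMod n, k.val := Equiv.sum_comp y ZMod.val
  have := (Finset.sum_eq_sum_iff_of_le (fun k _ => lower _ k rfl)).1 hsum.symm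
  ext1 k
  exact ZMod.val_injective n (this k (Finset.mem_univ k)).symm

theorem exists_move (y : Equiv.Perm (ZMod n)) (A B : ZMod n → ℤ) (hA0 : ∀ i, 0 ≤ A i)
    (hA1 : A (-1) = 0) (hB0 : ∀ i, 0 ≤ B i) (hB1 : B (-1) = 0)
    (h : ¬ (y = 1 ∧ (∀ i, A i = 0) ∧ ∀ i, B i = 0)) : Nonempty (Move y A B) := by
  by_cases hB : ∃ i, B i ≠ 0
  · exact move_B y A B hB0 hB1 hB
  push Not at hB
  by_cases hy : y = 1
  · have hA : ∃ i, A i ≠ 0 := by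
      by_contra hcon
      push Not at hcon
      exact h ⟨hy, hcon, hB⟩
    obtain ⟨M⟩ := move_B y⁻¹ B A hA0 hA1 hA
    have M' := M.transpose
    rw [inv_inv] at M'
    exact ⟨M'⟩
  · obtain ⟨k, hk, hk'⟩ := exists_descent y hy
    exact move_y y A B hB k hk hk'

theorem trivial_key {x : Equiv.Perm (ZMod n)} {D : ZMod n → ZMod n → ℤ}
    (hD : IsGridPosDomain n x 1 D) (hA : ∀ j, D (-1) j = 0) (hB : ∀ i, D i (-1) = 0) :
    x = 1 ∧ D = 0 := by
  have hall : ∀ m : ℕ, ∀ i : ZMod n, i.val = m → (x i = i ∧ ∀ j, D i j = 0) := by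
    intro m
    induction m using Nat.strong_induction_on with
    | _ m ih =>
    intro i hi
    have hprev : ∀ j, D (i - 1) j = 0 := by
      by_cases h0 : i.val = 0
      · have : i = 0 := by rwa [ZMod.val_eq_zero] at h0
        rw [this, zero_sub]
        exact hA
      · have : (i - 1).val = i.val - 1 := by rw [val_sub_one, if_neg h0]
        exact (ih (i.val - 1) (by omega) (i - 1) this).2
    have hj : ∀ j : ZMod n, D i j = (if (x i).val ≤ j.val then 1 else 0) -
        (if i.val ≤ j.val then 1 else 0) := by
      intro j
      have := jump hD i j
      rw [hprev, hB, hB, Equiv.Perm.one_apply] at this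
      linarith
    have hle : (x i).val ≤ i.val := by
      have h1 := hj i
      have h2 := hD.2 i i
      by_contra hcon
      rw [if_neg hcon, if_pos le_rfl] at h1
      linarith
    have hxi : x i = i := by
      by_contra hne
      have h3 := val_ne hne
      exact hne (x.injective (ih (x i).val (by omega) (x i) rfl).1)
    refine ⟨hxi, fun j => ?_⟩
    have := hj j
    rw [hxi] at this
    linarith
  constructor
  · ext1 i
    exact (hall _ i rfl).1
  · funext i j
    exact (hall _ i rfl).2 j

end GridCD
end

section
namespace GridCD
set_option linter.unusedSectionVars false
variable {n : ℕ} [NeZero n]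

theorem sub_pos {x w y : Equiv.Perm (ZMod n)} {R D : ZMod n → ZMod n → ℤ}
    (hR : IsGridRect n x w R) (hD : IsGridPosDomain n x y D) (hle : ∀ i j, R i j ≤ D i j) :
    IsGridPosDomain n w y (D - R) := by
  refine ⟨⟨?_, fun i j => ?_⟩, fun i j => ?_⟩
  · simp only [Pi.sub_apply, hR.1.1.1, hD.1.1]; rfl
  · have h1 := hR.1.1.2 i j
    have h2 := hD.1.2 i j
    simp only [Pi.sub_apply]
    linarith
  · simp only [Pi.sub_apply]
    have := hle i j
    linarith

/-- upper elements of the matching -/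
def isUp (x y : Equiv.Perm (ZMod n)) (A B : ZMod n → ℤ) : Prop :=
  ∃ h : Nonempty (Move y A B), (Classical.choice h).up x

/-- upper generators -/
def isP (g : GenCD n) : Prop :=
  isUp g.1.1 g.1.2.1 (g.1.2.2 (-1)) (fun i => g.1.2.2 i (-1))

theorem tau_exists (g : GenCD n) (h : isP g) : ∃ q : GenCD n,
    q.1 = ((Classical.choice h.1).σ g.1.1, g.1.2.1, g.1.2.2 - (Classical.choice h.1).R g.1.1) := by
  refine ⟨⟨_, ?_⟩, rfl⟩
  obtain ⟨hM, hup⟩ := h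
  exact sub_pos ((Classical.choice hM).rect _ hup) g.2
    ((Classical.choice hM).le _ _ g.2 (fun _ => rfl) (fun _ => rfl) hup)

open Classical in
/-- the matching -/
noncomputable def tau (g : GenCD n) : GenCD n :=
  if h : isP g then Classical.choose (tau_exists g h) else g

theorem tau_spec (g : GenCD n) (h : isP g) : (tau g).1 =
    ((Classical.choice h.1).σ g.1.1, g.1.2.1, g.1.2.2 - (Classical.choice h.1).R g.1.1) := by
  unfold tau
  rw [dif_pos h]
  exact Classical.choose_spec (tau_exists g h)

/-- rank on keys -/
def rk (y : Equiv.Perm (ZMod n)) (A B : ZMod n → ℤ) : ℕ ×ₗ ℕ :=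
  toLex ((∑ j, A j + ∑ i, B i).toNat, ∑ i : ZMod n, (n - i.val) * (y i).val)

/-- rank -/
def rho (g : GenCD n) : ℕ ×ₗ ℕ := rk g.1.2.1 (g.1.2.2 (-1)) (fun i => g.1.2.2 i (-1))

theorem f_lt (w : Equiv.Perm (ZMod n)) (a b : ZMod n) (hab : a.val < b.val)
    (hw : (w a).val < (w b).val) :
    ∑ i : ZMod n, (n - i.val) * (w i).val <
      ∑ i : ZMod n, (n - i.val) * ((w * Equiv.swap a b) i).val := by
  classical
  have hne : a ≠ b := by rintro rfl; omega
  have split : ∀ f : ZMod n → ℕ, ∑ i, f i = f a + (f b + ∑ i ∈ (Finset.univ.erase a).erase b, f i) := by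
    intro f
    rw [Finset.add_sum_erase _ f (by simp [Ne.symm hne]), Finset.add_sum_erase _ f (by simp)]
  rw [split, split]
  have hrest : ∑ i ∈ (Finset.univ.erase a).erase b, (n - i.val) * ((w * Equiv.swap a b) i).val =
      ∑ i ∈ (Finset.univ.erase a).erase b, (n - i.val) * (w i).val := by
    refine Finset.sum_congr rfl fun i hi => ?_
    simp only [Finset.mem_erase] at hi
    rw [Equiv.Perm.mul_apply, Equiv.swap_apply_of_ne_of_ne hi.2.1 hi.1]
  rw [hrest]
  simp only [Equiv.Perm.mul_apply, Equiv.swap_apply_left, Equiv.swap_apply_right]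
  have hb := ZMod.val_lt b
  obtain ⟨u, hu⟩ : ∃ u, n - b.val = u := ⟨_, rfl⟩
  obtain ⟨v, hv⟩ : ∃ v, n - a.val = u + v + 1 := ⟨b.val - a.val - 1, by omega⟩
  obtain ⟨p, hp⟩ : ∃ p, (w a).val = p := ⟨_, rfl⟩
  obtain ⟨q, hq⟩ : ∃ q, (w b).val = p + q + 1 := ⟨(w b).val - (w a).val - 1, by omega⟩
  rw [hu, hv, hp, hq]
  nlinarith [Nat.zero_le (v * q)]

theorem tot_lt (D R : ZMod n → ZMod n → ℤ) (hR : ∀ i j, 0 ≤ R i j) (hE : ∀ i j, 0 ≤ (D - R) i j)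
    (hnp : ¬ ((∀ j, R (-1) j = 0) ∧ ∀ i, R i (-1) = 0)) :
    (∑ j, (D - R) (-1) j + ∑ i, (D - R) i (-1)).toNat < (∑ j, D (-1) j + ∑ i, D i (-1)).toNat := by
  have h1 : 0 ≤ ∑ j, (D - R) (-1) j := Finset.sum_nonneg fun j _ => hE _ _
  have h2 : 0 ≤ ∑ i, (D - R) i (-1) := Finset.sum_nonneg fun j _ => hE _ _
  have h3 : 0 ≤ ∑ j, R (-1) j := Finset.sum_nonneg fun j _ => hR _ _
  have h4 : 0 ≤ ∑ i, R i (-1) := Finset.sum_nonneg fun j _ => hR _ _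
  have h5 : ¬ (∑ j, R (-1) j = 0 ∧ ∑ i, R i (-1) = 0) := by
    rintro ⟨k1, k2⟩
    apply hnp
    rw [Finset.sum_eq_zero_iff_of_nonneg (fun j _ => hR _ _)] at k1 k2
    exact ⟨fun j => k1 j (Finset.mem_univ _), fun i => k2 i (Finset.mem_univ _)⟩
  simp only [Pi.sub_apply, Finset.sum_sub_distrib] at h1 h2 ⊢
  omega

theorem key_sub (D R : ZMod n → ZMod n → ℤ) (h1 : ∀ j, R (-1) j = 0) (h2 : ∀ i, R i (-1) = 0) :
    (D - R) (-1) = D (-1) ∧ (fun i => (D - R) i (-1)) = fun i => D i (-1) := by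
  constructor
  · funext j; simp [h1]
  · funext i; simp [h2]

theorem key_add (D R : ZMod n → ZMod n → ℤ) (h1 : ∀ j, R (-1) j = 0) (h2 : ∀ i, R i (-1) = 0) :
    (D + R) (-1) = D (-1) ∧ (fun i => (D + R) i (-1)) = fun i => D i (-1) := by
  constructor
  · funext j; simp [h1]
  · funext i; simp [h2]

/-- the trivial generator -/
def genc (n : ℕ) : GenCD n := ⟨(1, 1, 0), isGridPosDomain_zero n 1⟩

theorem key_trivial (g : GenCD n) (h1 : g.1.2.1 = 1) (h2 : ∀ j, g.1.2.2 (-1) j = 0)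
    (h3 : ∀ i, g.1.2.2 i (-1) = 0) : g = genc n := by
  obtain ⟨⟨x, y, D⟩, hg⟩ := g
  simp only at h1 h2 h3
  subst h1
  obtain ⟨rfl, rfl⟩ := trivial_key hg h2 h3
  rfl

theorem not_isP_c : ¬ isP (genc n) := by
  rintro ⟨hM, hup⟩
  have h := (Classical.choice hM).le 1 0 (isGridPosDomain_zero n 1) (fun _ => rfl) (fun _ => rfl) hup
  obtain ⟨i, j, hij⟩ := rect_ne_zero ((Classical.choice hM).rect _ hup)
  have h' := h i j
  have : (1 : ℤ) ≤ 0 := by rw [← hij]; exact h'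
  norm_num at this

theorem key_tau (p : GenCD n) (hp : isP p) : (tau p).1.2.1 = p.1.2.1 ∧
    (tau p).1.2.2 (-1) = p.1.2.2 (-1) ∧
    (fun i => (tau p).1.2.2 i (-1)) = fun i => p.1.2.2 i (-1) := by
  rw [tau_spec p hp]
  have := key_sub p.1.2.2 ((Classical.choice hp.1).R p.1.1)
    ((Classical.choice hp.1).planarA _ hp.2) ((Classical.choice hp.1).planarB _ hp.2)
  exact ⟨rfl, this.1, this.2⟩

theorem isUp_iff {x y : Equiv.Perm (ZMod n)} {A B : ZMod n → ℤ} (h : Nonempty (Move y A B)) :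
    isUp x y A B ↔ (Classical.choice h).up x := ⟨fun ⟨_, h'⟩ => h', fun h' => ⟨h, h'⟩⟩

theorem homology_main (sgn : SignAssignment n) (grd : MaslovGrading n) (v : CDModule n)
    (hv : deltaCD n sgn grd v = 0) : ∃ (m : ℤ) (w : CDModule n),
      v = m • Finsupp.single (genc n) 1 + deltaCD n sgn grd w := by
  have hc : deltaCD n sgn grd (Finsupp.single (genc n) 1) = 0 := by
    rw [← T_gen]; exact delta_c sgn grd 1
  refine morse (deltaCD n sgn grd) (delta_sq sgn grd) (genc n) hc rho isP tau ?_ ?_ ?_ ?_ ?_ ?_ ?_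
    not_isP_c v hv
  · intro p hp
    rw [← T_gen]
    exact delta_coef_unit sgn grd _ _ _ _ _ _ ((Classical.choice hp.1).rect _ hp.2) (tau_spec p hp)
  · intro p hp hq
    obtain ⟨k1, k2, k3⟩ := key_tau p hp
    unfold isP at hq
    rw [k1, k2, k3, isUp_iff hp.1, tau_spec p hp, (Classical.choice hp.1).up_σ] at hq
    exact hq hp.2
  · intro p hp hq
    obtain ⟨k1, k2, k3⟩ := key_tau p hp
    rw [hq] at k1 k2 k3
    have : p = genc n := key_trivial p k1.symm (fun j => by rw [← k2]; rfl)
      (fun i => (congrFun k3 i).symm)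
    rw [this] at hp
    exact not_isP_c hp
  · intro p hp
    obtain ⟨k1, k2, k3⟩ := key_tau p hp
    unfold rho
    rw [k1, k2, k3]
  · intro p p' hp hp' he
    obtain ⟨k1, k2, k3⟩ := key_tau p hp
    obtain ⟨k1', k2', k3'⟩ := key_tau p' hp'
    have t := tau_spec p hp
    have t' := tau_spec p' hp'
    rw [he] at k1 k2 k3 t
    rw [t'] at t
    obtain ⟨⟨x, y, D⟩, hD⟩ := p
    obtain ⟨⟨x', y', D'⟩, hD'⟩ := p'
    simp only at *
    have ey : y' = y := k1'.symm.trans k1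
    have eA : D' (-1) = D (-1) := k2'.symm.trans k2
    have eB : (fun i => D' i (-1)) = fun i => D i (-1) := k3'.symm.trans k3
    subst ey
    have gen : ∀ (A A' B B' : ZMod n → ℤ) (h : Nonempty (Move y' A B)) (h' : Nonempty (Move y' A' B')),
        A' = A → B' = B → (Classical.choice h').σ = (Classical.choice h).σ ∧
          (Classical.choice h').R = (Classical.choice h).R := by
      rintro A A' B B' h h' rfl rfl
      exact ⟨rfl, rfl⟩
    obtain ⟨g1, g2⟩ := gen _ _ _ _ hp.1 hp'.1 eA eB
    simp only [Prod.mk.injEq, true_and] at t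
    rw [g1, g2] at t
    have ex : x' = x := by
      have := congrArg (Classical.choice hp.1).σ t.1
      rwa [(Classical.choice hp.1).σσ, (Classical.choice hp.1).σσ] at this
    subst ex
    have eD := sub_left_injective t.2
    subst eD
    rfl
  · intro q hq hqc
    obtain ⟨⟨x, y, D⟩, hD⟩ := q
    have hM : Nonempty (Move y (D (-1)) (fun i => D i (-1))) := by
      have h0 : D (-1) (-1) = 0 := by have := hD.1.1; rwa [cast_sub_one] at this
      apply exists_move y (D (-1)) (fun i => D i (-1)) (fun j => hD.2 (-1) j) h0 (fun i => hD.2 i (-1)) h0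
      rintro ⟨h1, h2, h3⟩
      exact hqc (key_trivial _ h1 h2 h3)
    set M := Classical.choice hM with hMdef
    have hnup : ¬ M.up x := fun h => hq ⟨hM, h⟩
    have hup : M.up (M.σ x) := (M.up_σ x).2 hnup
    have hrect := M.rect _ hup
    rw [M.σσ] at hrect
    have hD' : IsGridPosDomain n (M.σ x) y (M.R (M.σ x) + D) := pos_add_left hrect.1 hD
    rw [add_comm] at hD'
    obtain ⟨e1, e2⟩ := key_add D (M.R (M.σ x)) (M.planarA _ hup) (M.planarB _ hup)
    have hp : isP (⟨(M.σ x, y, D + M.R (M.σ x)), hD'⟩ : GenCD n) := by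
      unfold isP
      simp only
      rw [e1, e2]
      exact ⟨hM, hup⟩
    refine ⟨_, hp, ?_⟩
    apply Subtype.ext
    rw [tau_spec _ hp]
    have gen : ∀ (A B : ZMod n → ℤ) (h : Nonempty (Move y A B)), A = D (-1) →
        B = (fun i => D i (-1)) → (Classical.choice h).σ = M.σ ∧ (Classical.choice h).R = M.R := by
      rintro A B h rfl rfl
      exact ⟨rfl, rfl⟩
    obtain ⟨g1, g2⟩ := gen _ _ hp.1 e1 e2
    simp only
    rw [g1, g2, M.σσ, add_sub_cancel_right]
  · intro p q hp hq hqc hqt hcoef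
    rw [← T_gen] at hcoef
    have hts := tau_spec p hp
    obtain ⟨⟨x, y, D⟩, hD⟩ := p
    obtain ⟨⟨x', y', D'⟩, hD'⟩ := q
    simp only at hcoef hts
    have nonplanar : ∀ u v R, IsGridRect n u v R → D' = D - R →
        ¬ ((∀ j, R (-1) j = 0) ∧ ∀ i, R i (-1) = 0) →
        rho (⟨(x', y', D'), hD'⟩ : GenCD n) < rho (⟨(x, y, D), hD⟩ : GenCD n) := by
      intro u v R hR hDR hnp
      subst hDR
      unfold rho rk
      rw [Prod.Lex.toLex_lt_toLex]
      left
      exact tot_lt D R hR.1.2 hD'.2 hnp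
    rcases delta_coef sgn grd x y D _ hcoef with ⟨w, R, hR, he⟩ | ⟨w, R, hR, he⟩
    · simp only [Prod.mk.injEq] at he
      obtain ⟨rfl, rfl, rfl⟩ := he
      by_cases hpl : (∀ j, R (-1) j = 0) ∧ ∀ i, R i (-1) = 0
      · exfalso
        obtain ⟨e1, e2⟩ := key_sub D R hpl.1 hpl.2
        have hnup : ¬ (Classical.choice hp.1).up x' := by
          intro h
          apply hq
          unfold isP
          simp only
          rw [e1, e2]
          exact ⟨hp.1, h⟩
        obtain ⟨f1, f2⟩ := (Classical.choice hp.1).uniq _ _ _ hR hpl.1 hpl.2 hp.2 hnup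
        apply hqt
        apply Subtype.ext
        rw [hts, ← f1, ← f2]
      · exact nonplanar _ _ R hR rfl hpl
    · simp only [Prod.mk.injEq] at he
      obtain ⟨rfl, rfl, rfl⟩ := he
      by_cases hpl : (∀ j, R (-1) j = 0) ∧ ∀ i, R i (-1) = 0
      · obtain ⟨e1, e2⟩ := key_sub D R hpl.1 hpl.2
        obtain ⟨a, b, hab, hxab, hy, -, -⟩ := planar_iff hR hpl.1 hpl.2
        unfold rho
        simp only
        rw [e1, e2]
        unfold rk
        rw [Prod.Lex.toLex_lt_toLex]
        right
        refine ⟨rfl, ?_⟩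
        simp only
        rw [hy]
        exact f_lt _ a b hab hxab
      · exact nonplanar _ _ R hR rfl hpl

theorem homology_three (sgn : SignAssignment n) (grd : MaslovGrading n) (m : ℤ) (w : CDModule n)
    (h : m • Finsupp.single (genc n) 1 = deltaCD n sgn grd w) : m = 0 := by
  have h1 := congrArg (eps n) h
  rw [eps_delta, map_smul, ← T_gen, eps_T, if_pos ⟨rfl, rfl⟩] at h1
  simpa using h1

end GridCD
end

/-- The homology of the complex of positive domains is `ℤ`, supported in grading `0`
and generated by a trivial domain. -/
theorem homology_deltaCD (n : ℕ) (hn : 1 ≤ n)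
    (sgn : SignAssignment n) (grd : MaslovGrading n) :
    ∃ x₀ : Equiv.Perm (ZMod n),
      deltaCD n sgn grd
          (Finsupp.single (⟨(x₀, x₀, 0), isGridPosDomain_zero n x₀⟩ : GenCD n) (1 : ℤ)) = 0 ∧
      (∀ v : CDModule n, deltaCD n sgn grd v = 0 →
        ∃ (m : ℤ) (w : CDModule n),
          v = m • Finsupp.single (⟨(x₀, x₀, 0), isGridPosDomain_zero n x₀⟩ : GenCD n) (1 : ℤ) +
              deltaCD n sgn grd w) ∧
      (∀ (m : ℤ) (w : CDModule n),
        m • Finsupp.single (⟨(x₀, x₀, 0), isGridPosDomain_zero n x₀⟩ : GenCD n) (1 : ℤ) =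
            deltaCD n sgn grd w → m = 0) := by
  haveI : NeZero n := ⟨by omega⟩
  refine ⟨1, ?_, ?_, ?_⟩
  · have := GridCD.delta_c sgn grd (1 : Equiv.Perm (ZMod n))
    have e := GridCD.T_gen (⟨(1, 1, 0), isGridPosDomain_zero n 1⟩ : GenCD n)
    rw [← e]
    exact this
  · exact GridCD.homology_main sgn grd
  · exact GridCD.homology_three sgn grd
end

section
/- Let x and y be grid states and let D ∈ 𝒟⁺(x,y) be a positive domain such that D contains no horizontal annulus (that is, for every j ≠ n−1 the function D − H_(j) is not everywhere nonnegative) and A(D) ≠ 0. Then there exist a grid state z, a positive domain E ∈ 𝒟⁺(x,z), and a rectangle R ∈ ℛ(z,y) such that E∗R = D and A(R) ≠ 0. -/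
/-- Walking to the right along a horizontal line. -/
theorem gr_walkR (F : ℤ → ℤ → ℤ) (Y : ℤ → ℤ → Prop)
    (H : ∀ a b, ¬ Y a b → F (a-1) b + F a (b-1) ≤ F a b + F (a-1) (b-1))
    (L v i : ℤ) (h0 : F v (L-1) < F v L) (hY : ∀ a, v < a → a < i → ¬ Y a L) :
    ∀ a, v ≤ a → a < i → F a (L-1) < F a L := by
  intro a ha
  induction a, ha using Int.leInduction with
  | base => intro _; exact h0
  | succ a ha ih =>
    intro hai
    have h1 := ih (by omega)
    have h2 := H (a+1) L (hY _ (by omega) hai)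
    simp only [add_sub_cancel_right] at h2
    linarith

/-- Walking to the left along a horizontal line. -/
theorem gr_walkL (F : ℤ → ℤ → ℤ) (Y : ℤ → ℤ → Prop)
    (H : ∀ a b, ¬ Y a b → F (a-1) b + F a (b-1) ≤ F a b + F (a-1) (b-1))
    (L u i : ℤ) (h0 : F u L < F u (L-1)) (hY : ∀ a, i < a → a ≤ u → ¬ Y a L) :
    ∀ a, a ≤ u → i ≤ a → F a L < F a (L-1) := by
  intro a ha
  induction a, ha using Int.leInductionDown with
  | base => intro _; exact h0
  | pred a ha ih =>
    intro hai
    have h1 := ih (by omega)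
    have h2 := H a L (hY _ (by omega) ha)
    linarith

/-- Rows carrying a candidate south-east corner. -/
def GrSE (F : ℤ → ℤ → ℤ) (Y : ℤ → ℤ → Prop) (k L : ℤ) : Prop :=
  ∃ i, k < i ∧ Y i L ∧ ∀ a, k ≤ a → a < i → 0 < F a L

/-- Rows carrying a candidate north-west corner. -/
def GrNW (F : ℤ → ℤ → ℤ) (Y : ℤ → ℤ → Prop) (k L : ℤ) : Prop :=
  ∃ i, i ≤ k ∧ Y i L ∧ ∀ a, i ≤ a → a ≤ k → 0 < F a (L-1)

theorem gr_fact1 (F : ℤ → ℤ → ℤ) (Y : ℤ → ℤ → Prop) (hF : ∀ a b, 0 ≤ F a b)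
    (H : ∀ a b, ¬ Y a b → F (a-1) b + F a (b-1) ≤ F a b + F (a-1) (b-1))
    (hR : ∀ v b, ∃ i, v < i ∧ Y i b)
    (k L p q : ℤ) (hp : p ≤ k) (hq : k ≤ q)
    (hpos : ∀ a, p ≤ a → a ≤ q → 0 < F a L)
    (hz : ∃ v, p ≤ v ∧ v ≤ q ∧ F v (L-1) = 0) : GrSE F Y k L ∨ GrNW F Y k L := by
  obtain ⟨v, ⟨hv1, hv2, hv3⟩, hvmax⟩ := Int.exists_greatest_of_bdd
    (P := fun v => p ≤ v ∧ v ≤ q ∧ F v (L-1) = 0) ⟨q, fun z h => h.2.1⟩ hz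
  obtain ⟨i, ⟨hi1, hi2⟩, himin⟩ := Int.exists_least_of_bdd
    (P := fun i => v < i ∧ Y i L) ⟨v, fun z h => h.1.le⟩ (hR v L)
  have hw := gr_walkR F Y H L v i (by rw [hv3]; exact hpos v hv1 hv2)
    (fun a h1 h2 h3 => by have := himin a ⟨h1, h3⟩; omega)
  by_cases hik : k < i
  · left
    refine ⟨i, hik, hi2, fun a h1 h2 => ?_⟩
    by_cases hav : v ≤ a
    · exact lt_of_le_of_lt (hF _ _) (hw a hav h2)
    · exact hpos a (by omega) (by omega)
  · right
    refine ⟨i, by omega, hi2, fun a h1 h2 => ?_⟩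
    refine lt_of_le_of_ne (hF _ _) (fun h => ?_)
    have := hvmax a ⟨by omega, by omega, h.symm⟩
    omega

theorem gr_fact2 (F : ℤ → ℤ → ℤ) (Y : ℤ → ℤ → Prop) (hF : ∀ a b, 0 ≤ F a b)
    (H : ∀ a b, ¬ Y a b → F (a-1) b + F a (b-1) ≤ F a b + F (a-1) (b-1))
    (hL : ∀ v b, ∃ i, i ≤ v ∧ Y i b)
    (k L p q : ℤ) (hp : p ≤ k) (hq : k ≤ q)
    (hpos : ∀ a, p ≤ a → a ≤ q → 0 < F a (L-1))
    (hz : ∃ v, p ≤ v ∧ v ≤ q ∧ F v L = 0) : GrSE F Y k L ∨ GrNW F Y k L := by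
  obtain ⟨u, ⟨hv1, hv2, hv3⟩, hvmin⟩ := Int.exists_least_of_bdd
    (P := fun v => p ≤ v ∧ v ≤ q ∧ F v L = 0) ⟨p, fun z h => h.1⟩ hz
  obtain ⟨i, ⟨hi1, hi2⟩, himax⟩ := Int.exists_greatest_of_bdd
    (P := fun i => i ≤ u ∧ Y i L) ⟨u, fun z h => h.1⟩ (hL u L)
  have hw := gr_walkL F Y H L u i (by rw [hv3]; exact hpos u hv1 hv2)
    (fun a h1 h2 h3 => by have := himax a ⟨h2, h3⟩; omega)
  by_cases hik : k < i
  · left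
    refine ⟨i, hik, hi2, fun a h1 h2 => ?_⟩
    refine lt_of_le_of_ne (hF _ _) (fun h => ?_)
    have := hvmin a ⟨by omega, by omega, h.symm⟩
    omega
  · right
    refine ⟨i, by omega, hi2, fun a h1 h2 => ?_⟩
    by_cases hav : a ≤ u
    · exact lt_of_le_of_lt (hF _ _) (hw a hav h1)
    · exact hpos a (by omega) (by omega)

/-- A positive rectangle with corners `(i₀,t)` and `(i₁,m)` meeting column `k`. -/
def GrRect (F : ℤ → ℤ → ℤ) (Y : ℤ → ℤ → Prop) (k i₀ i₁ m t : ℤ) : Prop :=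
  i₀ ≤ k ∧ k < i₁ ∧ m < t ∧ Y i₀ t ∧ Y i₁ m ∧
    ∀ a b, i₀ ≤ a → a < i₁ → m ≤ b → b < t → 0 < F a b

theorem gr_exists (F : ℤ → ℤ → ℤ) (Y : ℤ → ℤ → Prop) (hF : ∀ a b, 0 ≤ F a b)
    (H : ∀ a b, ¬ Y a b → F (a-1) b + F a (b-1) ≤ F a b + F (a-1) (b-1))
    (hR : ∀ v b, ∃ i, v < i ∧ Y i b) (hL : ∀ v b, ∃ i, i ≤ v ∧ Y i b)
    (k c d : ℤ) (hcd : c < d) (hc : 0 < F k c) (hc' : F k (c-1) = 0)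
    (hd : 0 < F k (d-1)) (hd' : F k d = 0) :
    ∃ i₀ i₁ m t, GrRect F Y k i₀ i₁ m t := by
  have hSEc : GrSE F Y k c := by
    rcases gr_fact1 F Y hF H hR k c k k le_rfl le_rfl
      (fun a h1 h2 => by obtain rfl : a = k := by omega
                         exact hc) ⟨k, le_rfl, le_rfl, hc'⟩ with h | ⟨i, h1, h2, h3⟩
    · exact h
    · have := h3 k h1 le_rfl; omega
  have hNWd : GrNW F Y k d := by
    rcases gr_fact2 F Y hF H hL k d k k le_rfl le_rfl
      (fun a h1 h2 => by obtain rfl : a = k := by omega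
                         exact hd) ⟨k, le_rfl, le_rfl, hd'⟩ with ⟨i, h1, h2, h3⟩ | h
    · have := h3 k le_rfl h1; omega
    · exact h
  obtain ⟨t, ⟨ht1, ht2⟩, htmin⟩ := Int.exists_least_of_bdd
    (P := fun t => c < t ∧ GrNW F Y k t) ⟨c, fun z h => h.1.le⟩ ⟨d, hcd, hNWd⟩
  obtain ⟨m, ⟨hm1, hm2⟩, hmmax⟩ := Int.exists_greatest_of_bdd
    (P := fun m => m < t ∧ GrSE F Y k m) ⟨t, fun z h => h.1.le⟩ ⟨c, ht1, hSEc⟩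
  have hcm : c ≤ m := hmmax c ⟨ht1, hSEc⟩
  have hno : ∀ L, m < L → L < t → ¬ (GrSE F Y k L ∨ GrNW F Y k L) := by
    rintro L h1 h2 (h | h)
    · have := hmmax L ⟨h2, h⟩; omega
    · have := htmin L ⟨by omega, h⟩; omega
  have hup : ∀ p q, p ≤ k → k ≤ q → (∀ a, p ≤ a → a ≤ q → 0 < F a m) →
      ∀ b, m ≤ b → b < t → ∀ a, p ≤ a → a ≤ q → 0 < F a b := by
    intro p q hp hq h0 b hb
    induction b, hb using Int.leInduction with
    | base => intro _; exact h0
    | succ b hb ih =>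
      intro hbt a ha1 ha2
      by_contra hneg
      refine hno (b+1) (by omega) hbt (gr_fact2 F Y hF H hL k (b+1) p q hp hq ?_
        ⟨a, ha1, ha2, by have := hF a (b+1); omega⟩)
      rw [add_sub_cancel_right]
      exact ih (by omega)
  have hdown : ∀ p q, p ≤ k → k ≤ q → (∀ a, p ≤ a → a ≤ q → 0 < F a (t-1)) →
      ∀ b, b ≤ t-1 → m ≤ b → ∀ a, p ≤ a → a ≤ q → 0 < F a b := by
    intro p q hp hq h0 b hb
    induction b, hb using Int.leInductionDown with
    | base => intro _; exact h0
    | pred b hb ih =>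
      intro hbt a ha1 ha2
      by_contra hneg
      exact hno b (by omega) (by omega) (gr_fact1 F Y hF H hR k b p q hp hq
        (ih (by omega)) ⟨a, ha1, ha2, by have := hF a (b-1); omega⟩)
  obtain ⟨i₁, h1, h2, h3⟩ := hm2
  obtain ⟨i₀, g1, g2, g3⟩ := ht2
  refine ⟨i₀, i₁, m, t, g1, h1, hm1, g2, h2, fun a b ha ha' hb hb' => ?_⟩
  by_cases hak : a ≤ k
  · exact hdown i₀ k g1 le_rfl g3 b (by omega) hb a ha hak
  · exact hup k (i₁-1) le_rfl (by omega) (fun a h h' => h3 a h (by omega)) b hb hb' a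
      (by omega) (by omega)

/-- An innermost rectangle. -/
theorem gr_exists_empty (F : ℤ → ℤ → ℤ) (Y : ℤ → ℤ → Prop) (k : ℤ)
    (h : ∃ i₀ i₁ m t, GrRect F Y k i₀ i₁ m t) :
    ∃ i₀ i₁ m t, GrRect F Y k i₀ i₁ m t ∧
      ∀ a b, i₀ < a → a < i₁ → m < b → b < t → ¬ Y a b := by
  obtain ⟨w, ⟨i₀, i₁, m, t, hw, hr⟩, hmin⟩ := Int.exists_least_of_bdd
    (P := fun w => ∃ i₀ i₁ m t, w = i₁ - i₀ ∧ GrRect F Y k i₀ i₁ m t)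
    ⟨0, by rintro z ⟨i₀, i₁, m, t, rfl, h⟩; have := h.1; have := h.2.1; omega⟩
    (by obtain ⟨i₀, i₁, m, t, h⟩ := h; exact ⟨_, i₀, i₁, m, t, rfl, h⟩)
  refine ⟨i₀, i₁, m, t, hr, fun a b h1 h2 h3 h4 hY => ?_⟩
  obtain ⟨r1, r2, r3, r4, r5, r6⟩ := hr
  by_cases hak : a ≤ k
  · have := hmin (i₁ - a) ⟨a, i₁, m, b, rfl, hak, r2, h3, hY, r5,
      fun a' b' e1 e2 e3 e4 => r6 a' b' (by omega) e2 e3 (by omega)⟩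
    omega
  · have := hmin (a - i₀) ⟨i₀, a, b, t, rfl, r1, by omega, h4, r4, hY,
      fun a' b' e1 e2 e3 e4 => r6 a' b' e1 (by omega) (by omega) e4⟩
    omega

theorem gr_cyc_iff (n : ℕ) [NeZero n] (a b i : ZMod n) :
    cycInt n a b i ↔ (i - a).val < (b - a).val := by
  constructor
  · rintro ⟨k, hk, rfl⟩
    rw [add_sub_cancel_left, ZMod.val_natCast_of_lt (hk.trans (ZMod.val_lt _))]
    exact hk
  · intro h
    exact ⟨(i - a).val, h, by simp⟩

open Classical in
theorem gr_cyc_diff (n : ℕ) [NeZero n] (a b i : ZMod n) (hab : a ≠ b) :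
    ((if cycInt n a b i then 1 else 0) - (if cycInt n a b (i-1) then 1 else 0) : ℤ) =
      (if i = a then 1 else 0) - (if i = b then 1 else 0) := by
  simp only [gr_cyc_iff]
  obtain ⟨u, rfl⟩ : ∃ u, i = u + a := ⟨i - a, by ring⟩
  obtain ⟨w, rfl⟩ : ∃ w, b = w + a := ⟨b - a, by ring⟩
  have hw : w ≠ 0 := by rintro rfl; simp at hab
  have e : u + a - 1 - a = u - 1 := by ring
  simp only [add_sub_cancel_right, e, add_eq_right, add_left_inj]
  have hwv : w.val ≠ 0 := by rwa [Ne, ZMod.val_eq_zero]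
  have hwlt := ZMod.val_lt w
  have hinj : u = w ↔ u.val = w.val := ⟨fun h => by rw [h], fun h => ZMod.val_injective n h⟩
  by_cases hu : u = 0
  · subst hu
    have h1 : ((0:ZMod n) - 1).val = n - 1 := by
      obtain ⟨m, rfl⟩ : ∃ m, n = m + 1 := ⟨n - 1, by omega⟩
      rw [zero_sub, ZMod.val_neg_one]; simp
    rw [h1]
    have : ¬ (n - 1 < w.val) := by omega
    have h3 : 0 < w.val := by omega
    simp [this, h3, hw.symm]
  · have huv : u.val ≠ 0 := by rwa [Ne, ZMod.val_eq_zero]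
    have hn2 : 1 < n := by have := ZMod.val_lt u; omega
    haveI : Fact (1 < n) := ⟨hn2⟩
    have h1 : (u - 1).val = u.val - 1 := by
      rw [ZMod.val_sub (by rw [ZMod.val_one]; omega), ZMod.val_one]
    rw [h1]
    simp only [hu, if_false, hinj]
    split_ifs <;> first | omega | rfl

/-- Cyclic interval between integer lifts. -/
theorem gr_cyc_cast (n : ℕ) [NeZero n] (a b : ℤ) (h : a < b) (hn : b - a < n) (i : ZMod n) :
    cycInt n (a : ZMod n) (b : ZMod n) i ↔ ∃ c : ℤ, a ≤ c ∧ c < b ∧ i = (c : ZMod n) := by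
  have hv : ((((b : ZMod n) - (a : ZMod n)).val : ℕ) : ℤ) = b - a := by
    rw [← Int.cast_sub, ZMod.val_intCast, Int.emod_eq_of_lt (by omega) hn]
  constructor
  · rintro ⟨k, hk, rfl⟩
    exact ⟨a + k, by omega, by omega, by push_cast; rfl⟩
  · rintro ⟨c, h1, h2, rfl⟩
    refine ⟨(c - a).toNat, by omega, ?_⟩
    have : ((c - a).toNat : ℤ) = c - a := by omega
    have h3 : (((c - a).toNat : ℤ) : ZMod n) = ((c - a : ℤ) : ZMod n) := by rw [this]
    rw [Int.cast_natCast] at h3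
    rw [h3]; push_cast; ring

/-- Every residue has a lift in each window of length `n`. -/
theorem gr_lift (n : ℕ) [NeZero n] (a : ℤ) (i : ZMod n) :
    ∃ c : ℤ, a ≤ c ∧ c < a + n ∧ (c : ZMod n) = i := by
  refine ⟨a + ((i - (a : ZMod n)).val : ℤ), by omega, ?_, ?_⟩
  · have := ZMod.val_lt (i - (a : ZMod n)); omega
  · push_cast
    rw [ZMod.natCast_zmod_val]; ring

theorem gr_lt_of_zero (n : ℕ) [NeZero n] (a b : ℤ) (i : ZMod n)
    (h : ∀ c : ℤ, a ≤ c → c < b → (c : ZMod n) ≠ i) : b - a < n := by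
  obtain ⟨c, h1, h2, h3⟩ := gr_lift n a i
  by_contra hge
  exact h c h1 (by omega) h3

/-- Lemma 3.3 (`lem:starting-rectangle`, horizontal case): if a positive domain `D` from `x`
to `y` contains no horizontal annulus and `A(D) ≠ 0`, then `D` decomposes as `E ∗ R` with
`R` a rectangle ending at `y` having `A(R) ≠ 0`. -/
theorem exists_final_rectangle (n : ℕ) (hn : 1 ≤ n)
    (x y : Equiv.Perm (ZMod n)) (D : ZMod n → ZMod n → ℤ)
    (hD : IsGridPosDomain n x y D)
    (hnoH : ∀ j : ZMod n, j ≠ (n : ZMod n) - 1 →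
      ¬ ∀ i j' : ZMod n, 0 ≤ D i j' - annH n j i j')
    (hA : colA n D ≠ 0) :
    ∃ (z : Equiv.Perm (ZMod n)) (E R : ZMod n → ZMod n → ℤ),
      IsGridPosDomain n x z E ∧ IsGridRect n z y R ∧ E + R = D ∧ colA n R ≠ 0 := by
  classical
  haveI : NeZero n := ⟨by omega⟩
  obtain ⟨⟨hD0, hDd⟩, hDpos⟩ := hD
  obtain ⟨j₀, hj₀⟩ : ∃ j, D ((n : ZMod n) - 1) j ≠ 0 := by
    by_contra hcon
    push Not at hcon
    exact hA (funext fun j => hcon j.1)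
  have hnum : ((n : ZMod n) - 1) = ((-1 : ℤ) : ZMod n) := by simp
  rw [hnum] at hD0 hj₀
  have hrow : ∀ j, ∃ i, D i j = 0 := by
    intro j
    by_cases hj : j = (n : ZMod n) - 1
    · exact ⟨_, by rw [hj, hnum]; exact hD0⟩
    · have h := hnoH j hj
      push Not at h
      obtain ⟨i, j', h⟩ := h
      unfold annH at h
      have := hDpos i j'
      split_ifs at h with hjj
      · subst hjj; exact ⟨i, by omega⟩
      · omega
  set F : ℤ → ℤ → ℤ := fun a b => D (a : ZMod n) (b : ZMod n) with hFdef
  set Y : ℤ → ℤ → Prop := fun a b => y (a : ZMod n) = (b : ZMod n) with hYdef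
  have hF : ∀ a b, 0 ≤ F a b := fun a b => hDpos _ _
  have H : ∀ a b, ¬ Y a b → F (a-1) b + F a (b-1) ≤ F a b + F (a-1) (b-1) := by
    intro a b hab
    have h := hDd (a : ZMod n) (b : ZMod n)
    rw [if_neg hab] at h
    simp only [hFdef]
    push_cast
    split_ifs at h <;> linarith
  have hR : ∀ v b, ∃ i, v < i ∧ Y i b := by
    intro v b
    obtain ⟨c, h1, h2, h3⟩ := gr_lift n (v+1) (y.symm (b : ZMod n))
    exact ⟨c, by omega, by simp [hYdef, h3]⟩
  have hL : ∀ v b, ∃ i, i ≤ v ∧ Y i b := by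
    intro v b
    obtain ⟨c, h1, h2, h3⟩ := gr_lift n (v+1-n) (y.symm (b : ZMod n))
    exact ⟨c, by omega, by simp [hYdef, h3]⟩
  -- the component of the rightmost column
  obtain ⟨J, -, -, hJ⟩ := gr_lift n 0 j₀
  have hFJ : F (-1) J ≠ 0 := by simp only [hFdef]; rw [hJ]; exact hj₀
  obtain ⟨zd, -, hz1, hz2⟩ := gr_lift n (J+1-n) ((-1 : ℤ) : ZMod n)
  obtain ⟨zu, hz3, -, hz4⟩ := gr_lift n J ((-1 : ℤ) : ZMod n)
  have hFzd : F (-1) zd = 0 := by simp only [hFdef]; rw [hz2]; exact hD0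
  have hFzu : F (-1) zu = 0 := by simp only [hFdef]; rw [hz4]; exact hD0
  obtain ⟨c, ⟨hc1, hc2⟩, hcmax⟩ := Int.exists_greatest_of_bdd
    (P := fun c => c ≤ J ∧ F (-1) c = 0) ⟨J, fun z h => h.1⟩ ⟨zd, by omega, hFzd⟩
  obtain ⟨d, ⟨hd1, hd2⟩, hdmin⟩ := Int.exists_least_of_bdd
    (P := fun c => J ≤ c ∧ F (-1) c = 0) ⟨J, fun z h => h.1⟩ ⟨zu, by omega, hFzu⟩
  have hcJ : c ≠ J := by rintro rfl; exact hFJ hc2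
  have hdJ : d ≠ J := by rintro rfl; exact hFJ hd2
  have hcpos : 0 < F (-1) (c+1) := by
    refine lt_of_le_of_ne (hF _ _) fun h => ?_
    have := hcmax (c+1) ⟨by omega, h.symm⟩; omega
  have hdpos : 0 < F (-1) (d-1) := by
    refine lt_of_le_of_ne (hF _ _) fun h => ?_
    have := hdmin (d-1) ⟨by omega, h.symm⟩; omega
  obtain ⟨i₀, i₁, m, t, ⟨r1, r2, r3, r4, r5, r6⟩, hempty⟩ := gr_exists_empty F Y (-1)
    (gr_exists F Y hF H hR hL (-1) (c+1) d (by omega) hcpos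
      (by rw [add_sub_cancel_right]; exact hc2) hdpos hd2)
  -- sizes
  have hwid : i₁ - i₀ < n := by
    obtain ⟨i, hi⟩ := hrow (m : ZMod n)
    refine gr_lt_of_zero n i₀ i₁ i fun a h1 h2 h3 => ?_
    have := r6 a m h1 h2 le_rfl r3
    simp only [hFdef] at this
    rw [h3, hi] at this; omega
  have hhei : t - m < n := by
    refine gr_lt_of_zero n m t ((-1 : ℤ) : ZMod n) fun a h1 h2 h3 => ?_
    have := r6 (-1) a r1 r2 h1 h2
    simp only [hFdef] at this
    rw [h3, hD0] at this; omega
  have hne : ∀ a b : ℤ, a < b → b - a < n → (a : ZMod n) ≠ (b : ZMod n) := by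
    intro a b h1 h2 h
    have h3 := (ZMod.intCast_eq_intCast_iff_dvd_sub a b n).1 h
    have := Int.le_of_dvd (by omega) h3
    omega
  have hine := hne i₀ i₁ (by omega) hwid
  have htne := hne m t r3 hhei
  have hcI := gr_cyc_cast n i₀ i₁ (by omega) hwid
  have hcJ' := gr_cyc_cast n m t r3 hhei
  simp only [hYdef] at r4 r5
  set z : Equiv.Perm (ZMod n) := y * Equiv.swap (i₀ : ZMod n) (i₁ : ZMod n) with hz
  have hz0 : z (i₀ : ZMod n) = (m : ZMod n) := by simp [hz, r5]
  have hz1 : z (i₁ : ZMod n) = (t : ZMod n) := by simp [hz, r4]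
  have hzo : ∀ i, i ≠ (i₀ : ZMod n) → i ≠ (i₁ : ZMod n) → z i = y i := by
    intro i h1 h2
    simp [hz, Equiv.swap_apply_of_ne_of_ne h1 h2]
  set f : ZMod n → ℤ := fun i => if cycInt n (i₀ : ZMod n) (i₁ : ZMod n) i then 1 else 0 with hf
  set g : ZMod n → ℤ := fun j => if cycInt n (m : ZMod n) (t : ZMod n) j then 1 else 0 with hg
  set R : ZMod n → ZMod n → ℤ := fun i j => f i * g j with hRdef
  have hR1 : ∀ i j, (cycInt n (i₀ : ZMod n) (i₁ : ZMod n) i ∧ cycInt n (m : ZMod n) (t : ZMod n) j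
      → R i j = 1) ∧ (¬ (cycInt n (i₀ : ZMod n) (i₁ : ZMod n) i ∧
        cycInt n (m : ZMod n) (t : ZMod n) j) → R i j = 0) := by
    intro i j
    simp only [hRdef, hf, hg]
    split_ifs <;> simp_all
  have hRD : ∀ i j, R i j ≤ D i j := by
    intro i j
    by_cases h : cycInt n (i₀ : ZMod n) (i₁ : ZMod n) i ∧ cycInt n (m : ZMod n) (t : ZMod n) j
    · rw [(hR1 i j).1 h]
      obtain ⟨a, h1, h2, rfl⟩ := (hcI i).1 h.1
      obtain ⟨b, h3, h4, rfl⟩ := (hcJ' j).1 h.2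
      exact r6 a b h1 h2 h3 h4
    · rw [(hR1 i j).2 h]; exact hDpos i j
  have hR0 : ∀ i j, 0 ≤ R i j := by
    intro i j
    by_cases h : cycInt n (i₀ : ZMod n) (i₁ : ZMod n) i ∧ cycInt n (m : ZMod n) (t : ZMod n) j
    · rw [(hR1 i j).1 h]; norm_num
    · rw [(hR1 i j).2 h]
  have hRcorner : R ((-1 : ℤ) : ZMod n) ((-1 : ℤ) : ZMod n) = 0 :=
    le_antisymm (hD0 ▸ hRD _ _) (hR0 _ _)
  have hRd : ∀ i j : ZMod n, R i j - R (i - 1) j - R i (j - 1) + R (i - 1) (j - 1) =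
        (if z i = j then 1 else 0) - (if y i = j then 1 else 0) := by
    intro i j
    have e : R i j - R (i - 1) j - R i (j - 1) + R (i - 1) (j - 1) =
        (f i - f (i-1)) * (g j - g (j-1)) := by simp only [hRdef]; ring
    rw [e, gr_cyc_diff n _ _ i hine, gr_cyc_diff n _ _ j htne]
    by_cases h0 : i = (i₀ : ZMod n)
    · subst h0
      rw [hz0, r4]
      simp only [hine, if_true, if_false, eq_comm (a := j)]
      ring
    · by_cases h1 : i = (i₁ : ZMod n)
      · subst h1
        rw [hz1, r5]
        simp only [h0, if_true, if_false, eq_comm (a := j)]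
        ring
      · rw [hzo i h0 h1]
        simp [h0, h1]
  refine ⟨z, fun i j => D i j - R i j, R, ⟨⟨?_, ?_⟩, ?_⟩, ⟨⟨⟨?_, hRd⟩, hR0⟩,
    (i₀ : ZMod n), (i₁ : ZMod n), hine, ?_, ?_, ?_⟩, ?_, ?_⟩
  · simp only [hnum]; rw [hD0, hRcorner]; rfl
  · intro i j
    have h1 := hDd i j
    have h2 := hRd i j
    simp only
    linarith
  · intro i j
    have := hRD i j
    simp only
    omega
  · rw [hnum]; exact hRcorner
  · rw [hz, mul_assoc, Equiv.swap_mul_self, mul_one]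
  · rw [hz0, hz1]; exact hR1
  · intro i h0 h1 hi hj
    rw [hz0, hz1, hzo i h0 h1] at hj
    obtain ⟨a, e1, e2, rfl⟩ := (hcI i).1 hi
    obtain ⟨b, e3, e4, hb⟩ := (hcJ' _).1 hj
    have ha : a ≠ i₀ := by rintro rfl; exact h0 rfl
    have hbm : b ≠ m := by
      rintro rfl
      exact h1 (y.injective (hb.trans r5.symm))
    exact hempty a b (by omega) e2 (by omega) e4 hb
  · funext i j
    simp
  · intro h
    have hmn : (m : ZMod n) ≠ (n : ZMod n) - 1 := by
      rw [hnum]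
      intro hm
      have := r6 (-1) m r1 r2 le_rfl r3
      simp only [hFdef] at this
      rw [hm, hD0] at this; omega
    have h1 := congrFun h ⟨(m : ZMod n), hmn⟩
    simp only [colA, Pi.zero_apply] at h1
    rw [hnum, (hR1 _ _).1 ⟨(hcI _).2 ⟨-1, r1, r2, rfl⟩, (hcJ' _).2 ⟨m, le_rfl, r3, rfl⟩⟩] at h1
    omega
end
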